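/- There exists a positive real constant c such that for every integer t ≥ 3 there exist a natural number n with n ≥ c·t²/log t, a natural number r, and a simple graph G on n vertices which is triangle-free, r-regular, and has independence number α(G) < t. Equivalently, the regular Ramsey number R^reg(3,t), defined as the maximal n for which there exists a regular graph on n vertices containing neither a triangle nor an independent set of size t, satisfies R^reg(3,t) ≥ c·t²/log t, and hence R^reg(3,t) = Θ(t²/log t). -/

import Mathlib

section
open Finset


/-- Bipartite realisation of a degree sequence. -/
theorem bip_exists {X : Type*} [DecidableEq X] (A : Finset X) (f : X → ℕ) (k : ℕ) (hk : 1 ≤ k)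
    (hf1 : ∀ x ∈ A, k ≤ f x) (hf2 : ∀ x ∈ A, f x ≤ 2 * k) (hA : 10 * k < A.card) :
    ∃ H : Finset (X × X), H ⊆ A ×ˢ A ∧ (∀ x ∈ A, (A.filter (fun y => (x, y) ∈ H)).card = f x) ∧
      (∀ y ∈ A, (A.filter (fun x => (x, y) ∈ H)).card = f y) := by
  classical
  let row (H : Finset (X × X)) (x : X) := (A.filter (fun y => (x, y) ∈ H)).card
  let col (H : Finset (X × X)) (y : X) := (A.filter (fun x => (x, y) ∈ H)).card
  have hrow : ∀ H : Finset (X × X), H ⊆ A ×ˢ A → H.card = ∑ x ∈ A, row H x := by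
    intro H hH
    have : H = (A ×ˢ A).filter (fun p => p ∈ H) := by
      ext p; simp only [mem_filter]; exact ⟨fun h => ⟨hH h, h⟩, fun h => h.2⟩
    conv_lhs => rw [this]
    rw [card_filter, sum_product]
    simp only [row, card_filter]
  have hcol : ∀ H : Finset (X × X), H ⊆ A ×ˢ A → H.card = ∑ x ∈ A, col H x := by
    intro H hH
    have : H = (A ×ˢ A).filter (fun p => p ∈ H) := by
      ext p; simp only [mem_filter]; exact ⟨fun h => ⟨hH h, h⟩, fun h => h.2⟩
    conv_lhs => rw [this]
    rw [card_filter, sum_product_right]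
    simp only [col, card_filter]
  let S := ((A ×ˢ A).powerset).filter (fun H => (∀ x ∈ A, row H x ≤ f x) ∧ (∀ x ∈ A, col H x ≤ f x))
  have hS : S.Nonempty := ⟨∅, by simp [S, row, col]⟩
  obtain ⟨H, hHS, hmax⟩ := exists_max_image S card hS
  simp only [S, mem_filter, mem_powerset] at hHS
  obtain ⟨hHA, hHr, hHc⟩ := hHS
  have key : ∀ u ∈ A, row H u = f u := by
    intro u hu
    by_contra hne
    have hlt : row H u < f u := lt_of_le_of_ne (hHr u hu) hne
    have hsum : H.card < ∑ x ∈ A, f x := by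
      rw [hrow H hHA]; exact sum_lt_sum hHr ⟨u, hu, hlt⟩
    have hadd : ∀ v ∈ A, col H v < f v → (u, v) ∈ H := by
      intro v hv hcv
      by_contra hn
      have hr : ∀ x ∈ A, row (insert (u,v) H) x ≤ f x := by
        intro x hx
        by_cases hxu : x = u
        · subst hxu
          have : row (insert (x,v) H) x ≤ row H x + 1 := by
            have : A.filter (fun y => (x, y) ∈ insert (x,v) H) ⊆
                insert v (A.filter (fun y => (x, y) ∈ H)) := by
              intro y; simp; tauto
            exact (card_le_card this).trans (card_insert_le _ _)
          omega
        · have : row (insert (u,v) H) x = row H x := by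
            simp [row, hxu]
          rw [this]; exact hHr x hx
      have hc : ∀ x ∈ A, col (insert (u,v) H) x ≤ f x := by
        intro x hx
        by_cases hxv : x = v
        · subst hxv
          have : col (insert (u,x) H) x ≤ col H x + 1 := by
            have : A.filter (fun y => (y, x) ∈ insert (u,x) H) ⊆
                insert u (A.filter (fun y => (y, x) ∈ H)) := by
              intro y; simp; tauto
            exact (card_le_card this).trans (card_insert_le _ _)
          omega
        · have : col (insert (u,v) H) x = col H x := by
            simp [col, hxv]
          rw [this]; exact hHc x hx
      have hm : insert (u,v) H ∈ S := by
        simp only [S, mem_filter, mem_powerset]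
        refine ⟨?_, hr, hc⟩
        intro p hp
        rcases mem_insert.1 hp with rfl | hp
        · simp [hu, hv]
        · exact hHA hp
      have := hmax _ hm
      rw [card_insert_of_notMem hn] at this
      omega
    obtain ⟨v, hv, hcv⟩ : ∃ v ∈ A, col H v < f v := by
      by_contra hcon
      push Not at hcon
      have := sum_le_sum hcon
      rw [← hcol H hHA] at this
      omega
    -- many edges
    have hdef : (A.filter (fun y => col H y < f y)).card ≤ 2 * k := by
      calc (A.filter (fun y => col H y < f y)).card ≤ row H u := by
            apply card_le_card; intro y; simp only [mem_filter]
            rintro ⟨h1, h2⟩; exact ⟨h1, hadd y h1 h2⟩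
        _ ≤ _ := (hHr u hu).trans (hf2 u hu)
    have hfull : A.card ≤ (A.filter (fun y => ¬ col H y < f y)).card + 2 * k := by
      have := card_filter_add_card_filter_not (s := A) (fun y => col H y < f y)
      omega
    have hbig : (A.filter (fun y => ¬ col H y < f y)).card * k ≤ H.card := by
      rw [hcol H hHA]
      calc _ = ∑ y ∈ A.filter (fun y => ¬ col H y < f y), k := by simp
        _ ≤ ∑ y ∈ A.filter (fun y => ¬ col H y < f y), col H y := by
            apply sum_le_sum; intro y hy; simp only [mem_filter] at hy
            have := hf1 y hy.1; omega
        _ ≤ _ := sum_le_sum_of_subset (filter_subset _ _)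
    have hB1 : (H.filter (fun p => (u, p.2) ∈ H)).card ≤ 2 * k * (2 * k) := by
      have : H.filter (fun p => (u, p.2) ∈ H) ⊆
          (A.filter (fun y => (u, y) ∈ H)).biUnion
            (fun y => (A.filter (fun x => (x,y) ∈ H)).image (fun x => (x,y))) := by
        intro p hp
        simp only [mem_filter] at hp
        have := mem_product.1 (hHA hp.1)
        simp only [mem_biUnion, mem_filter, mem_image]
        exact ⟨p.2, ⟨this.2, hp.2⟩, p.1, ⟨this.1, hp.1⟩, rfl⟩
      refine (card_le_card this).trans (card_biUnion_le.trans ?_)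
      calc _ ≤ ∑ y ∈ A.filter (fun y => (u, y) ∈ H), 2 * k := by
            apply sum_le_sum; intro y hy
            have hy := (mem_filter.1 hy).1
            exact card_image_le.trans ((hHc y hy).trans (hf2 y hy))
        _ = row H u * (2 * k) := by simp [row]
        _ ≤ _ := Nat.mul_le_mul_right _ ((hHr u hu).trans (hf2 u hu))
    have hB2 : (H.filter (fun p => (p.1, v) ∈ H)).card ≤ 2 * k * (2 * k) := by
      have : H.filter (fun p => (p.1, v) ∈ H) ⊆
          (A.filter (fun x => (x, v) ∈ H)).biUnion
            (fun x => (A.filter (fun y => (x,y) ∈ H)).image (fun y => (x,y))) := by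
        intro p hp
        simp only [mem_filter] at hp
        have := mem_product.1 (hHA hp.1)
        simp only [mem_biUnion, mem_filter, mem_image]
        exact ⟨p.1, ⟨this.1, hp.2⟩, p.2, ⟨this.2, hp.1⟩, rfl⟩
      refine (card_le_card this).trans (card_biUnion_le.trans ?_)
      calc _ ≤ ∑ y ∈ A.filter (fun x => (x, v) ∈ H), 2 * k := by
            apply sum_le_sum; intro y hy
            have hy := (mem_filter.1 hy).1
            exact card_image_le.trans ((hHr y hy).trans (hf2 y hy))
        _ = col H v * (2 * k) := by simp [col]
        _ ≤ _ := Nat.mul_le_mul_right _ ((hHc v hv).trans (hf2 v hv))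
    obtain ⟨⟨a, b⟩, hab, hub, hav⟩ : ∃ p ∈ H, (u, p.2) ∉ H ∧ (p.1, v) ∉ H := by
      by_contra hcon
      push Not at hcon
      have : H ⊆ H.filter (fun p => (u, p.2) ∈ H) ∪ H.filter (fun p => (p.1, v) ∈ H) := by
        intro p hp
        simp only [mem_union, mem_filter]
        by_cases h : (u, p.2) ∈ H
        · exact Or.inl ⟨hp, h⟩
        · exact Or.inr ⟨hp, hcon p hp h⟩
      have := (card_le_card this).trans (card_union_le _ _)
      nlinarith
    simp only at hub hav
    have huv := hadd v hv hcv
    have haA := mem_product.1 (hHA hab)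
    have hau : a ≠ u := by rintro rfl; exact hub hab
    have hbv : b ≠ v := by rintro rfl; exact hav hab
    let H' := insert (u,b) (insert (a,v) (H.erase (a,b)))
    have hr : ∀ x ∈ A, row H' x ≤ f x := by
      intro x hx
      by_cases hxu : x = u
      · subst hxu
        have : row H' x ≤ row H x + 1 := by
          have : A.filter (fun y => (x, y) ∈ H') ⊆
              insert b (A.filter (fun y => (x, y) ∈ H)) := by
            intro y; simp [H', hau.symm]; tauto
          exact (card_le_card this).trans (card_insert_le _ _)
        omega
      · by_cases hxa : x = a
        · subst hxa
          have : row H' x ≤ row H x := by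
            have h1 : A.filter (fun y => (x, y) ∈ H') ⊆
              insert v ((A.filter (fun y => (x, y) ∈ H)).erase b) := by
              intro y; simp [H', hxu]; tauto
            refine (card_le_card h1).trans ((card_insert_le _ _).trans ?_)
            have hb : b ∈ A.filter (fun y => (x, y) ∈ H) := by simp [hab]; exact haA.2
            rw [card_erase_of_mem hb]
            have := card_pos.2 ⟨b, hb⟩
            simp only [row]; omega
          exact this.trans (hHr x hx)
        · have : row H' x = row H x := by
            simp [row, H', hxu, hxa]
          rw [this]; exact hHr x hx
    have hc : ∀ x ∈ A, col H' x ≤ f x := by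
      intro x hx
      by_cases hxv : x = v
      · subst hxv
        have : col H' x ≤ col H x + 1 := by
          have : A.filter (fun y => (y, x) ∈ H') ⊆
              insert a (A.filter (fun y => (y, x) ∈ H)) := by
            intro y; simp [H', hbv.symm]; tauto
          exact (card_le_card this).trans (card_insert_le _ _)
        omega
      · by_cases hxb : x = b
        · subst hxb
          have : col H' x ≤ col H x := by
            have h1 : A.filter (fun y => (y, x) ∈ H') ⊆
              insert u ((A.filter (fun y => (y, x) ∈ H)).erase a) := by
              intro y; simp [H', hxv]; tauto
            refine (card_le_card h1).trans ((card_insert_le _ _).trans ?_)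
            have hb : a ∈ A.filter (fun y => (y, x) ∈ H) := by simp [hab]; exact haA.1
            rw [card_erase_of_mem hb]
            have := card_pos.2 ⟨a, hb⟩
            simp only [col]; omega
          exact this.trans (hHc x hx)
        · have : col H' x = col H x := by
            simp [col, H', hxv, hxb]
          rw [this]; exact hHc x hx
    have hm : H' ∈ S := by
      simp only [S, mem_filter, mem_powerset]
      refine ⟨?_, hr, hc⟩
      intro p hp
      rcases mem_insert.1 hp with rfl | hp
      · exact mem_product.2 ⟨hu, haA.2⟩
      rcases mem_insert.1 hp with rfl | hp
      · exact mem_product.2 ⟨haA.1, hv⟩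
      · exact hHA (mem_of_mem_erase hp)
    have := hmax _ hm
    simp only [H'] at this
    rw [card_insert_of_notMem (by simp [hub, hau.symm]), card_insert_of_notMem (by simp [hav]),
      card_erase_of_mem hab] at this
    have := card_pos.2 ⟨_, hab⟩
    omega
  refine ⟨H, hHA, key, ?_⟩
  have h1 : ∑ x ∈ A, col H x = ∑ x ∈ A, f x := by
    rw [← hcol H hHA, hrow H hHA]; exact sum_congr rfl key
  exact (sum_eq_sum_iff_of_le hHc).1 h1

theorem reg_graph {W ι : Type*} [Fintype W] [DecidableEq ι] (G : SimpleGraph W) (k M : ℕ)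
    (β : W → ι) (htf : ∀ x y z, G.Adj x y → G.Adj x z → ¬ G.Adj y z)
    (hα : ∀ s : Finset W, (∀ u ∈ s, ∀ v ∈ s, u ≠ v → ¬ G.Adj u v) → s.card < k)
    (hind : ∀ u v, β u = β v → ¬ G.Adj u v)
    (hblock : ∀ w, 10 * k < M * (univ.filter (fun w' => β w' = β w)).card) :
    ∃ (r : ℕ) (G' : SimpleGraph (Fin (Fintype.card ((W × Fin M) × Bool))))
      (_ : DecidableRel G'.Adj),
        G'.CliqueFree 3 ∧ G'.IsRegularOfDegree r ∧
        ∀ s : Finset (Fin (Fintype.card ((W × Fin M) × Bool))),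
          (∀ u ∈ s, ∀ v ∈ s, u ≠ v → ¬ G'.Adj u v) → s.card < 2 * M * k + 1 := by
  classical
  have hk : 1 ≤ k := by have := hα ∅ (by simp); rw [card_empty] at this; omega
  have hdeg : ∀ w, (univ.filter (fun v => G.Adj w v)).card < k := by
    intro w
    apply hα
    intro u hu v hv _
    simp only [mem_filter, mem_univ, true_and] at hu hv
    exact htf w u v hu hv
  let f : (W × Fin M) → ℕ := fun x => 2 * k - (univ.filter (fun v => G.Adj x.1 v)).card
  let A : ι → Finset (W × Fin M) := fun i => univ.filter (fun x => β x.1 = i)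
  have hA : ∀ x : (W × Fin M), 10 * k < (A (β x.1)).card := by
    intro x
    have : A (β x.1) = (univ.filter (fun w' => β w' = β x.1)) ×ˢ (univ : Finset (Fin M)) := by
      ext y; simp [A]
    rw [this, card_product, card_univ, Fintype.card_fin, mul_comm _ M]
    exact hblock _
  have hH : ∀ x : (W × Fin M), ∃ H : Finset ((W × Fin M) × (W × Fin M)), H ⊆ A (β x.1) ×ˢ A (β x.1) ∧
      (∀ y ∈ A (β x.1), ((A (β x.1)).filter (fun z => (y, z) ∈ H)).card = f y) ∧
      (∀ y ∈ A (β x.1), ((A (β x.1)).filter (fun z => (z, y) ∈ H)).card = f y) := by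
    intro x
    refine bip_exists _ f k hk ?_ ?_ (hA x)
    · intro y _; have := hdeg y.1; simp only [f]; omega
    · intro y _; simp only [f]; omega
  have hH' : ∀ i : ι, ∃ H : Finset ((W × Fin M) × (W × Fin M)), H ⊆ A i ×ˢ A i ∧
      (∀ y ∈ A i, ((A i).filter (fun z => (y, z) ∈ H)).card = f y) ∧
      (∀ y ∈ A i, ((A i).filter (fun z => (z, y) ∈ H)).card = f y) := by
    intro i
    by_cases h : ∃ x : (W × Fin M), β x.1 = i
    · obtain ⟨x, rfl⟩ := h; exact hH x
    · refine ⟨∅, by simp, ?_, ?_⟩ <;>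
      · intro y hy; exact absurd ⟨y, by simpa [A] using hy⟩ h
  choose Hs hHs1 hHs2 hHs3 using hH'
  let H : (W × Fin M) → (W × Fin M) → Prop := fun x y => (x, y) ∈ Hs (β x.1)
  have hHβ : ∀ x y, H x y → β x.1 = β y.1 := by
    intro x y h
    have := (mem_product.1 (hHs1 _ h)).2
    simp only [A, mem_filter, mem_univ, true_and] at this
    exact this.symm
  have hrow : ∀ x, (univ.filter (fun y => H x y)).card = f x := by
    intro x
    rw [← hHs2 (β x.1) x (by simp [A])]
    congr 1
    ext y
    simp only [mem_filter, mem_univ, true_and, A]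
    exact ⟨fun h => ⟨(hHβ _ _ h).symm, h⟩, fun h => h.2⟩
  have hcol : ∀ x, (univ.filter (fun y => H y x)).card = f x := by
    intro x
    rw [← hHs3 (β x.1) x (by simp [A])]
    congr 1
    ext y
    simp only [mem_filter, mem_univ, true_and, A]
    constructor
    · intro h; have h1 := hHβ _ _ h; refine ⟨h1, ?_⟩; rw [← h1]; exact h
    · rintro ⟨h1, h2⟩; show _ ∈ Hs _; rw [h1]; exact h2
  let K : SimpleGraph ((W × Fin M) × Bool) :=
    { Adj := fun a b => (a.2 = b.2 ∧ a.1.2 = b.1.2 ∧ G.Adj a.1.1 b.1.1) ∨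
        (a.2 = false ∧ b.2 = true ∧ H a.1 b.1) ∨ (a.2 = true ∧ b.2 = false ∧ H b.1 a.1)
      symm := ⟨by
        rintro a b (⟨h1, h2, h3⟩ | ⟨h1, h2, h3⟩ | ⟨h1, h2, h3⟩)
        · exact Or.inl ⟨h1.symm, h2.symm, h3.symm⟩
        · exact Or.inr (Or.inr ⟨h2, h1, h3⟩)
        · exact Or.inr (Or.inl ⟨h2, h1, h3⟩)⟩
      loopless := ⟨by
        rintro a (⟨h1, h2, h3⟩ | ⟨h1, h2, h3⟩ | ⟨h1, h2, h3⟩)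
        · exact G.loopless.irrefl _ h3
        · rw [h1] at h2; cases h2
        · rw [h1] at h2; cases h2⟩ }
  have hsame : ∀ a b : (W × Fin M) × Bool, a.2 = b.2 → K.Adj a b → a.1.2 = b.1.2 ∧ G.Adj a.1.1 b.1.1 := by
    rintro a b hab (⟨h1, h2, h3⟩ | ⟨h1, h2, h3⟩ | ⟨h1, h2, h3⟩)
    · exact ⟨h2, h3⟩
    · rw [hab, h2] at h1; cases h1
    · rw [hab, h2] at h1; cases h1
  have hdiff : ∀ a b : (W × Fin M) × Bool, a.2 ≠ b.2 → K.Adj a b → β a.1.1 = β b.1.1 := by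
    rintro a b hab (⟨h1, h2, h3⟩ | ⟨h1, h2, h3⟩ | ⟨h1, h2, h3⟩)
    · exact absurd h1 hab
    · exact hHβ _ _ h3
    · exact (hHβ _ _ h3).symm
  have htri : ∀ a b c : (W × Fin M) × Bool, a.2 = b.2 → K.Adj a b → K.Adj a c → K.Adj b c → False := by
    intro a b c hab h1 h2 h3
    by_cases hac : a.2 = c.2
    · exact htf _ _ _ (hsame _ _ hab h1).2 (hsame _ _ hac h2).2 (hsame _ _ (hab ▸ hac) h3).2
    · have e1 := hdiff _ _ hac h2
      have e2 := hdiff b c (hab ▸ hac) h3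
      exact hind _ _ (e1.trans e2.symm) (hsame _ _ hab h1).2
  have hK3 : K.CliqueFree 3 := by
    intro s hs
    obtain ⟨a, b, c, hab, hac, hbc, rfl⟩ := SimpleGraph.is3Clique_iff.1 hs
    by_cases h1 : a.2 = b.2
    · exact htri a b c h1 hab hac hbc
    by_cases h2 : a.2 = c.2
    · exact htri a c b h2 hac hab hbc.symm
    have h3 : b.2 = c.2 := by
      revert h1 h2; cases a.2 <;> cases b.2 <;> cases c.2 <;> simp
    exact htri b c a h3 hbc hab.symm hac.symm
  have hGcard : ∀ x : (W × Fin M), (univ.filter (fun y : (W × Fin M) => x.2 = y.2 ∧ G.Adj x.1 y.1)).card =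
      (univ.filter (fun v => G.Adj x.1 v)).card := by
    intro x
    symm
    apply card_bij (fun v _ => (v, x.2))
    · intro v hv; simpa using hv
    · intro v _ w _ h; simpa using h
    · rintro ⟨y1, y2⟩ hy
      simp only [mem_filter, mem_univ, true_and] at hy
      exact ⟨y1, by simpa using hy.2, by rw [hy.1]⟩
  have hKdeg : ∀ a : (W × Fin M) × Bool, (univ.filter (fun b => K.Adj a b)).card = 2 * k := by
    rintro ⟨x, b⟩
    have hx := hdeg x.1
    rw [card_filter, Fintype.sum_prod_type_right]
    rw [Fintype.sum_bool, ← card_filter (fun y => K.Adj (x, b) (y, true)), ← card_filter (fun y => K.Adj (x, b) (y, false))]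
    have h0 := hGcard x
    cases b
    · have e1 : (univ.filter (fun y => K.Adj (x, false) (y, true))) = univ.filter (fun y => H x y) := by
        ext y; simp [K]
      have e2 : (univ.filter (fun y => K.Adj (x, false) (y, false))) =
          univ.filter (fun y : (W × Fin M) => x.2 = y.2 ∧ G.Adj x.1 y.1) := by
        ext y; simp [K]
      rw [e1, e2, hrow, h0]; simp only [f]; omega
    · have e1 : (univ.filter (fun y => K.Adj (x, true) (y, false))) = univ.filter (fun y => H y x) := by
        ext y; simp [K]
      have e2 : (univ.filter (fun y => K.Adj (x, true) (y, true))) =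
          univ.filter (fun y : (W × Fin M) => x.2 = y.2 ∧ G.Adj x.1 y.1) := by
        ext y; simp [K]
      rw [e1, e2, hcol, h0]; simp only [f]; omega
  have hKα : ∀ s : Finset ((W × Fin M) × Bool), (∀ u ∈ s, ∀ v ∈ s, u ≠ v → ¬ K.Adj u v) →
      s.card ≤ 2 * M * k := by
    intro s hs
    have := card_le_mul_card_image_of_maps_to (s := s) (t := (univ : Finset (Fin M × Bool)))
      (f := fun a => (a.1.2, a.2)) (by simp) k (by
        rintro ⟨i, b⟩ _
        have : (s.filter (fun a => (a.1.2, a.2) = (i, b))).card =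
            ((s.filter (fun a => (a.1.2, a.2) = (i, b))).image (fun a => a.1.1)).card := by
          rw [card_image_of_injOn]
          rintro ⟨⟨w, i'⟩, b'⟩ h ⟨⟨w', i''⟩, b''⟩ h' hh
          simp at h h' hh ⊢
          grind
        rw [this]
        apply le_of_lt
        apply hα
        intro u hu v hv huv hadj
        simp only [mem_image, mem_filter, Prod.mk.injEq] at hu hv
        obtain ⟨a, ⟨ha, ha1, ha2⟩, rfl⟩ := hu
        obtain ⟨c, ⟨hc, hc1, hc2⟩, rfl⟩ := hv
        refine hs a ha c hc (fun h => huv (by rw [h])) ?_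
        exact Or.inl ⟨ha2.trans hc2.symm, ha1.trans hc1.symm, hadj⟩)
    refine this.trans (le_of_eq ?_)
    simp; ring
  let e : ((W × Fin M) × Bool) ≃ Fin (Fintype.card ((W × Fin M) × Bool)) := Fintype.equivFin _
  let G' : SimpleGraph (Fin (Fintype.card ((W × Fin M) × Bool))) := K.comap e.symm
  refine ⟨2 * k, G', Classical.decRel _, ?_, ?_, ?_⟩
  · exact hK3.comap ⟨(SimpleGraph.Embedding.comap e.symm.toEmbedding K).toCopy⟩
  · intro v
    rw [← hKdeg (e.symm v), ← SimpleGraph.card_neighborFinset_eq_degree]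
    apply card_bij (fun w _ => e.symm w)
    · intro w hw; simpa [G'] using hw
    · intro _ _ _ _ h; exact e.symm.injective h
    · intro w hw; exact ⟨e w, by simpa [G'] using hw, by simp⟩
  · intro s hs
    have := hKα (s.map e.symm.toEmbedding) (by
      intro u hu v hv huv hadj
      simp only [mem_map, Equiv.coe_toEmbedding] at hu hv
      obtain ⟨a, ha, rfl⟩ := hu
      obtain ⟨c, hc, rfl⟩ := hv
      exact hs a ha c hc (fun h => huv (by rw [h])) hadj)
    rw [card_map] at this
    omega

theorem few_edges {V : Type*} [DecidableEq V] (G : SimpleGraph V) [DecidableRel G.Adj]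
    (U : Finset V) (s k : ℕ) (hU : 2 * k ≤ U.card)
    (hs : ∀ v ∈ U, (U.filter (fun u => G.Adj v u)).card ≤ s) (i : ℕ) (hi : i ≤ k) :
    ∃ S ⊆ U, S.card = i ∧
      ((S ×ˢ S).filter (fun p => G.Adj p.1 p.2)).card * U.card ≤ 2 * i ^ 2 * s := by
  induction i with
  | zero => exact ⟨∅, by simp⟩
  | succ i ih =>
    obtain ⟨S, hSU, hSi, hSe⟩ := ih (by omega)
    have hc : (U \ S).card = U.card - i := by rw [card_sdiff_of_subset hSU, hSi]
    have hpos : (U \ S).Nonempty := by rw [← card_pos]; omega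
    obtain ⟨u, hu, hmin⟩ := exists_min_image (U \ S) (fun u => (S.filter (fun v => G.Adj u v)).card) hpos
    have hsum : (U \ S).card * (S.filter (fun v => G.Adj u v)).card ≤ i * s := by
      calc _ ≤ ∑ w ∈ U \ S, (S.filter (fun v => G.Adj w v)).card := by
            rw [← smul_eq_mul]; exact card_nsmul_le_sum _ _ _ hmin
        _ = ∑ v ∈ S, ((U \ S).filter (fun w => G.Adj w v)).card := by
            simp only [card_filter]; exact sum_comm
        _ ≤ ∑ v ∈ S, s := by
            apply sum_le_sum; intro v hv
            refine le_trans (card_le_card ?_) (hs v (hSU hv))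
            intro w hw
            simp only [mem_filter, mem_sdiff] at hw ⊢
            exact ⟨hw.1.1, hw.2.symm⟩
        _ = i * s := by simp [hSi]
    rw [mem_sdiff] at hu
    refine ⟨insert u S, insert_subset hu.1 hSU, by rw [card_insert_of_notMem hu.2, hSi], ?_⟩
    set d := (S.filter (fun v => G.Adj u v)).card with hd
    have hE : (((insert u S) ×ˢ (insert u S)).filter (fun p => G.Adj p.1 p.2)).card ≤
        ((S ×ˢ S).filter (fun p => G.Adj p.1 p.2)).card + 2 * d := by
      have : ((insert u S) ×ˢ (insert u S)).filter (fun p => G.Adj p.1 p.2) ⊆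
          ((S ×ˢ S).filter (fun p => G.Adj p.1 p.2)) ∪
          ((S.filter (fun v => G.Adj u v)).image (fun v => (u, v)) ∪
           (S.filter (fun v => G.Adj u v)).image (fun v => (v, u))) := by
        rintro ⟨a, b⟩ h
        simp only [mem_filter, mem_product, mem_insert, mem_union, mem_image, Prod.mk.injEq] at h ⊢
        obtain ⟨⟨rfl | ha, rfl | hb⟩, hab⟩ := h
        · exact absurd hab (G.loopless.irrefl _)
        · exact Or.inr (Or.inl ⟨b, ⟨hb, hab⟩, rfl, rfl⟩)
        · exact Or.inr (Or.inr ⟨a, ⟨ha, hab.symm⟩, rfl, rfl⟩)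
        · exact Or.inl ⟨⟨ha, hb⟩, hab⟩
      refine (card_le_card this).trans ((card_union_le _ _).trans ?_)
      refine Nat.add_le_add_left ((card_union_le _ _).trans ?_) _
      have h1 := card_image_le (s := S.filter (fun v => G.Adj u v)) (f := fun v => (u, v))
      have h2 := card_image_le (s := S.filter (fun v => G.Adj u v)) (f := fun v => (v, u))
      omega
    have hd2 : d * U.card ≤ 2 * (i * s) := by
      have : U.card ≤ 2 * (U \ S).card := by omega
      nlinarith
    calc _ ≤ (((S ×ˢ S).filter (fun p => G.Adj p.1 p.2)).card + 2 * d) * U.card :=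
          Nat.mul_le_mul_right _ hE
      _ ≤ 2 * i ^ 2 * s + 2 * (2 * (i * s)) := by nlinarith
      _ ≤ _ := by nlinarith

theorem peel {V : Type*} [Fintype V] [DecidableEq V] (G : SimpleGraph V) [DecidableRel G.Adj]
    (htf : ∀ x y z, G.Adj x y → G.Adj x z → ¬ G.Adj y z)
    (k j s : ℕ) (hs1 : 1 ≤ s) (hV : 4 * k ≤ Fintype.card V)
    (hj : 4 * k ^ 2 * s < j * Fintype.card V)
    (hmany : ∀ I : Finset V, I.card = k → j ≤ ((I ×ˢ I).filter (fun p => G.Adj p.1 p.2)).card) :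
    ∃ (W : Finset V) (β : V → V), Fintype.card V ≤ 2 * W.card ∧
      (∀ u ∈ W, ∀ v ∈ W, β u = β v → ¬ G.Adj u v) ∧
      ∀ w ∈ W, s ≤ (W.filter (fun w' => β w' = β w)).card := by
  classical
  let P : Finset V → Prop := fun W => ∃ β : V → V, (∀ w ∈ W, β w ∈ W) ∧
    (∀ u ∈ W, ∀ v ∈ W, β u = β v → ¬ G.Adj u v) ∧
      ∀ w ∈ W, s ≤ (W.filter (fun w' => β w' = β w)).card
  obtain ⟨W, hW, hmax⟩ := exists_max_image (univ.filter P) card ⟨∅, by simp only [mem_filter, mem_univ, true_and]; exact ⟨id, by simp⟩⟩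
  simp only [mem_filter, mem_univ, true_and] at hW hmax
  obtain ⟨β, h1, h2, h3⟩ := hW
  refine ⟨W, β, ?_, h2, h3⟩
  by_contra hlt
  push Not at hlt
  have hUc : Wᶜ.card + W.card = Fintype.card V := by rw [add_comm]; exact card_add_card_compl W
  obtain ⟨v, hv⟩ : ∃ v, s < (Wᶜ.filter (fun u => G.Adj v u)).card := by
    by_contra hcon
    push Not at hcon
    obtain ⟨S, hSU, hSk, hSe⟩ := few_edges G Wᶜ s k (by omega) (fun v _ => hcon v) k le_rfl
    have := hmany S hSk
    have h5 : j * Wᶜ.card ≤ 2 * k ^ 2 * s := le_trans (Nat.mul_le_mul_right _ this) hSe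
    have h6 : Fintype.card V ≤ 2 * Wᶜ.card := by omega
    nlinarith
  set T := Wᶜ.filter (fun u => G.Adj v u) with hT
  obtain ⟨t0, ht0⟩ : T.Nonempty := card_pos.1 (by omega)
  have hTW : ∀ t ∈ T, t ∉ W := by intro t ht; simp [T] at ht; exact ht.1
  have hTv : ∀ t ∈ T, G.Adj v t := by intro t ht; simp [T] at ht; exact ht.2
  let β' : V → V := fun x => if x ∈ T then t0 else β x
  have hβT : ∀ x ∈ T, β' x = t0 := by intro x hx; simp [β', hx]
  have hβW : ∀ x ∈ W, β' x = β x := by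
    intro x hx
    have : x ∉ T := fun h => hTW x h hx
    simp [β', this]
  have hPn : P (W ∪ T) := by
    refine ⟨β', ?_, ?_, ?_⟩
    · intro w hw
      rcases mem_union.1 hw with hw | hw
      · rw [hβW w hw]; exact mem_union_left _ (h1 w hw)
      · rw [hβT w hw]; exact mem_union_right _ ht0
    · intro a ha b hb hab
      rcases mem_union.1 ha with ha | ha <;> rcases mem_union.1 hb with hb | hb
      · rw [hβW a ha, hβW b hb] at hab; exact h2 a ha b hb hab
      · rw [hβW a ha, hβT b hb] at hab
        exact absurd (hab ▸ h1 a ha) (hTW t0 ht0)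
      · rw [hβT a ha, hβW b hb] at hab
        exact absurd (hab ▸ h1 b hb) (hTW t0 ht0)
      · exact htf v a b (hTv a ha) (hTv b hb)
    · intro w hw
      rcases mem_union.1 hw with hw | hw
      · refine (h3 w hw).trans (card_le_card ?_)
        intro x hx
        simp only [mem_filter, mem_union] at hx ⊢
        rw [hβW x hx.1, hβW w hw]
        exact ⟨Or.inl hx.1, hx.2⟩
      · refine hv.le.trans (card_le_card ?_)
        intro x hx
        rw [mem_filter, hβT x hx, hβT w hw]
        exact ⟨mem_union_right _ hx, rfl⟩
  have := hmax _ hPn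
  rw [card_union_of_disjoint (by
    rw [disjoint_left]; intro x hx hx'; exact hTW x hx' hx)] at this
  omega

theorem from_dense {V : Type*} [Fintype V] [DecidableEq V] (G : SimpleGraph V) [DecidableRel G.Adj]
    (htf : ∀ x y z, G.Adj x y → G.Adj x z → ¬ G.Adj y z)
    (k j s M : ℕ) (hs1 : 1 ≤ s) (hV : 4 * k ≤ Fintype.card V)
    (hj : 4 * k ^ 2 * s < j * Fintype.card V) (hM : 10 * k < M * s)
    (hmany : ∀ I : Finset V, I.card = k → j ≤ ((I ×ˢ I).filter (fun p => G.Adj p.1 p.2)).card) :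
    ∃ (n r : ℕ) (G' : SimpleGraph (Fin n)) (_ : DecidableRel G'.Adj),
        M * Fintype.card V ≤ n ∧
        G'.CliqueFree 3 ∧ G'.IsRegularOfDegree r ∧
        ∀ s : Finset (Fin n), (∀ u ∈ s, ∀ v ∈ s, u ≠ v → ¬ G'.Adj u v) → s.card < 2 * M * k + 1 := by
  classical
  obtain ⟨W, β, hW1, hW2, hW3⟩ := peel G htf k j s hs1 hV hj hmany
  have hj1 : 1 ≤ j := by
    rcases Nat.eq_zero_or_pos j with h | h
    · subst h; simp at hj
    · exact h
  obtain ⟨r, G', hdec, h1, h2, h3⟩ := reg_graph (W := {x // x ∈ W}) (G.comap Subtype.val) k M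
    (fun x => β x.1) (fun x y z => htf x.1 y.1 z.1) (by
      intro t ht
      by_contra hcon
      push Not at hcon
      obtain ⟨t', ht', htk⟩ := exists_subset_card_eq hcon
      have h4 := hmany (t'.map (Function.Embedding.subtype _)) (by rw [card_map, htk])
      have : 0 < (((t'.map (Function.Embedding.subtype _)) ×ˢ
        (t'.map (Function.Embedding.subtype _))).filter (fun p => G.Adj p.1 p.2)).card := by omega
      obtain ⟨⟨a, b⟩, hp⟩ := card_pos.1 this
      simp only [mem_filter, mem_product, mem_map, Function.Embedding.coe_subtype] at hp
      obtain ⟨⟨⟨a', ha, rfl⟩, ⟨b', hb, rfl⟩⟩, hab⟩ := hp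
      refine ht a' (ht' ha) b' (ht' hb) ?_ hab
      rintro rfl; exact G.loopless.irrefl _ hab)
    (fun u v h => hW2 u.1 u.2 v.1 v.2 h) (by
      intro w
      have h5 := hW3 w.1 w.2
      have h6 : (univ.filter (fun w' : {x // x ∈ W} => β w'.1 = β w.1)).card =
          (W.filter (fun w' => β w' = β w.1)).card := by
        rw [← card_map (Function.Embedding.subtype _)]
        congr 1
        ext x
        simp [and_comm]
      rw [h6]
      exact lt_of_lt_of_le hM (Nat.mul_le_mul_left _ h5))
  refine ⟨_, r, G', hdec, ?_, h1, h2, h3⟩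
  simp only [Fintype.card_prod, Fintype.card_coe, Fintype.card_fin, Fintype.card_bool]
  nlinarith

/-- Average over a finite type. -/
noncomputable def av {Ω : Type*} [Fintype Ω] (f : Ω → ℝ) : ℝ := (∑ x, f x) / Fintype.card Ω

open Classical in
/-- Uniform probability of an event on a finite type. -/
noncomputable def pr {Ω : Type*} [Fintype Ω] (P : Ω → Prop) : ℝ := av (fun x => if P x then 1 else 0)

section avlib
variable {Ω Ω' : Type*} [Fintype Ω] [Fintype Ω']

theorem av_mono {f g : Ω → ℝ} (h : ∀ x, f x ≤ g x) : av f ≤ av g := by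
  unfold av
  exact div_le_div_of_nonneg_right (sum_le_sum fun x _ => h x) (Nat.cast_nonneg _)

theorem av_nonneg {f : Ω → ℝ} (h : ∀ x, 0 ≤ f x) : 0 ≤ av f := by
  unfold av
  exact div_nonneg (sum_nonneg fun x _ => h x) (Nat.cast_nonneg _)

theorem av_const [Nonempty Ω] (c : ℝ) : av (fun _ : Ω => c) = c := by
  unfold av
  have : (Fintype.card Ω : ℝ) ≠ 0 := Nat.cast_ne_zero.2 Fintype.card_ne_zero
  simp only [sum_const, card_univ, nsmul_eq_mul]
  field_simp

theorem av_add (f g : Ω → ℝ) : av (fun x => f x + g x) = av f + av g := by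
  unfold av; rw [sum_add_distrib, add_div]

theorem av_sum {ι : Type*} (s : Finset ι) (f : ι → Ω → ℝ) :
    av (fun x => ∑ i ∈ s, f i x) = ∑ i ∈ s, av (f i) := by
  unfold av; rw [sum_comm, sum_div]

theorem av_mul (c : ℝ) (f : Ω → ℝ) : av (fun x => c * f x) = c * av f := by
  unfold av; rw [← mul_sum, mul_div_assoc]

theorem av_equiv (e : Ω ≃ Ω') (f : Ω' → ℝ) : av (fun x => f (e x)) = av f := by
  unfold av; rw [Equiv.sum_comp e, Fintype.card_congr e]

theorem av_prod (f : Ω × Ω' → ℝ) : av f = av (fun x => av (fun y => f (x, y))) := by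
  unfold av
  rw [Fintype.sum_prod_type, Fintype.card_prod, ← sum_div, div_div]
  push_cast; rw [mul_comm]

theorem av_pi {ι α : Type*} [Fintype ι] [DecidableEq ι] [Fintype α] (g : ι → α → ℝ) :
    av (fun ω : ι → α => ∏ i, g i (ω i)) = ∏ i, av (g i) := by
  unfold av
  rw [prod_div_distrib, prod_univ_sum, Fintype.piFinset_univ]
  congr 1
  simp

theorem av_succ {n : ℕ} {α : Type*} [Fintype α] (f : (Fin (n + 1) → α) → ℝ) :
    av f = av (fun x : α => av (fun ω : Fin n → α => f (Fin.cons x ω))) := by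
  rw [← av_prod (fun p : α × (Fin n → α) => f (Fin.cons p.1 p.2))]
  rw [← av_equiv (Fin.consEquiv (fun _ => α))]
  rfl

theorem pr_nonneg (P : Ω → Prop) : 0 ≤ pr P := by
  classical
  unfold pr; apply av_nonneg; intro x; split_ifs <;> norm_num

theorem pr_mono {P Q : Ω → Prop} (h : ∀ x, P x → Q x) : pr P ≤ pr Q := by
  classical
  unfold pr; apply av_mono; intro x
  by_cases hP : P x
  · simp [hP, h x hP]
  · simp only [hP, if_false]; split_ifs <;> norm_num

theorem pr_or {P Q : Ω → Prop} : pr (fun x => P x ∨ Q x) ≤ pr P + pr Q := by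
  classical
  unfold pr; rw [← av_add]; apply av_mono; intro x
  by_cases hP : P x <;> by_cases hQ : Q x <;> simp [hP, hQ]

theorem pr_exists {ι : Type*} [Fintype ι] (P : ι → Ω → Prop) :
    pr (fun x => ∃ i, P i x) ≤ ∑ i, pr (P i) := by
  classical
  unfold pr; rw [← av_sum]; apply av_mono; intro x
  split_ifs with h
  · obtain ⟨i, hi⟩ := h
    calc (1:ℝ) = if P i x then 1 else 0 := by simp [hi]
      _ ≤ _ := single_le_sum (f := fun i => if P i x then (1:ℝ) else 0)
        (fun j _ => by split_ifs <;> norm_num) (mem_univ i)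
  · apply sum_nonneg; intro j _; split_ifs <;> norm_num

theorem pr_exists_le {ι : Type*} [Fintype ι] (P : ι → Ω → Prop) (c : ℝ) (h : ∀ i, pr (P i) ≤ c) :
    pr (fun x => ∃ i, P i x) ≤ Fintype.card ι * c := by
  refine (pr_exists P).trans ?_
  calc _ ≤ ∑ _i : ι, c := sum_le_sum fun i _ => h i
    _ = _ := by simp

theorem exists_of_pr [Nonempty Ω] {P : Ω → Prop} (h : pr P < 1) : ∃ x, ¬ P x := by
  classical
  by_contra hcon
  push Not at hcon
  unfold pr at h
  simp only [hcon, if_true, av_const] at h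
  exact lt_irrefl _ h

theorem pr_markov {P : Ω → Prop} {f : Ω → ℝ} {c : ℝ} (hc : 0 < c) (hf : ∀ x, 0 ≤ f x)
    (h : ∀ x, P x → c ≤ f x) : pr P ≤ av f / c := by
  classical
  rw [le_div_iff₀ hc, mul_comm]
  unfold pr
  rw [← av_mul]
  apply av_mono; intro x
  split_ifs with hP
  · simpa using h x hP
  · simpa using hf x

theorem pr_equiv (e : Ω ≃ Ω') (P : Ω' → Prop) : pr (fun x => P (e x)) = pr P := by
  classical
  unfold pr
  exact av_equiv e (fun x => if P x then 1 else 0)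

theorem pr_prod_le [Nonempty Ω] (P : Ω × Ω' → Prop) (c : ℝ)
    (h : ∀ x, pr (fun y => P (x, y)) ≤ c) : pr P ≤ c := by
  classical
  unfold pr at h ⊢
  rw [av_prod]
  exact (av_mono h).trans (le_of_eq (av_const c))

theorem pr_prod_le' [Nonempty Ω'] (P : Ω × Ω' → Prop) (c : ℝ)
    (h : ∀ y, pr (fun x => P (x, y)) ≤ c) : pr P ≤ c := by
  rw [← pr_equiv (Equiv.prodComm Ω' Ω)]
  exact pr_prod_le _ c h

/-- Predictable products have mean at most one. -/
theorem av_predictable {α : Type*} [Fintype α] (n : ℕ) :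
    ∀ (X : Fin n → (Fin n → α) → ℝ) (_ : ∀ i ω, 0 ≤ X i ω)
      (_ : ∀ i ω ω', (∀ j ≤ i, ω j = ω' j) → X i ω = X i ω')
      (_ : ∀ i ω, av (fun x => X i (Function.update ω i x)) ≤ 1),
      av (fun ω => ∏ i, X i ω) ≤ 1 := by
  induction n with
  | zero =>
    intro X h0 h1 h2
    simp [av]
  | succ n ih =>
    intro X h0 h1 h2
    rw [av_succ]
    rcases isEmpty_or_nonempty α with hα | hα
    · simp [av]
    obtain ⟨a0⟩ := hα
    have step : ∀ x : α, av (fun ω : Fin n → α => ∏ i, X i (Fin.cons x ω)) ≤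
        X 0 (Function.update (fun _ => a0) 0 x) := by
      intro x
      have e : (fun ω : Fin n → α => ∏ i, X i (Fin.cons x ω)) =
          fun ω : Fin n → α => X 0 (Function.update (fun _ => a0) 0 x) *
            ∏ i : Fin n, X i.succ (Fin.cons x ω) := by
        funext ω
        rw [Fin.prod_univ_succ]
        congr 1
        apply h1
        intro j hj
        have : j = 0 := by simpa using hj
        subst this
        simp
      rw [e, av_mul]
      have := ih (fun i ω => X i.succ (Fin.cons x ω)) (fun i ω => h0 _ _) (by
          intro i ω ω' h
          apply h1
          intro j
          refine Fin.cases ?_ ?_ j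
          · intro _; simp
          · intro j hj; simp only [Fin.cons_succ]; exact h j (Fin.succ_le_succ_iff.1 hj)) (by
          intro i ω
          have := h2 i.succ (Fin.cons x ω)
          convert this using 3
          rw [Fin.cons_update])
      exact mul_le_of_le_one_right (h0 _ _) this
    exact (av_mono step).trans (h2 0 _)

end avlib

theorem av_bit (q : ℕ) (hq : 1 ≤ q) (u v : ℝ) :
    av (fun x : Fin q => if (x : ℕ) = 0 then u else v) = v + (u - v) / q := by
  obtain ⟨q, rfl⟩ : ∃ q', q = q' + 1 := ⟨q - 1, by omega⟩
  unfold av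
  rw [Fin.sum_univ_succ]
  simp
  field_simp
  ring

/-- Exposure lemma. -/
theorem exposure (m q : ℕ) (hq : 1 ≤ q) (Op : Fin m → (Fin m → Fin m → Fin q) → Finset (Fin m))
    (hOp : ∀ z M M', (∀ y < z, M y = M' y) → Op z M = Op z M') (T j : ℕ) :
    pr (fun M : Fin m → Fin m → Fin q => T ≤ ∑ z, (Op z M).card ∧
      ∑ z, ((Op z M).filter (fun a => (M z a : ℕ) = 0)).card < j) ≤
      2 ^ j * (1 - 1 / (2 * q : ℝ)) ^ T := by
  have hq' : (1:ℝ) ≤ q := by exact_mod_cast hq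
  set b : ℝ := 1 - 1 / (2 * q : ℝ) with hb
  have hb0 : 0 < b := by
    rw [hb, sub_pos, div_lt_one (by linarith)]; linarith
  have hb1 : b ≤ 1 := by
    rw [hb]; have : 0 ≤ 1 / (2 * q : ℝ) := by positivity
    linarith
  set X : Fin m → (Fin m → Fin m → Fin q) → ℝ := fun z M =>
    ∏ a ∈ Op z M, ((if (M z a : ℕ) = 0 then (1/2 : ℝ) else 1) / b) with hX
  have hXval : ∀ z M, X z M = (1/2 : ℝ) ^ ((Op z M).filter (fun a => (M z a : ℕ) = 0)).card /
      b ^ (Op z M).card := by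
    intro z M
    simp only [hX]
    rw [prod_div_distrib, prod_const, prod_ite, prod_const, prod_const_one, mul_one]
  have key : av (fun M => ∏ z, X z M) ≤ 1 := by
    apply av_predictable
    · intro z M; simp only [hX]; apply prod_nonneg; intro a _; split_ifs <;> positivity
    · intro z M M' h
      simp only [hX]
      rw [hOp z M M' (fun y hy => h y hy.le), h z le_rfl]
    · intro z M
      obtain ⟨g, hg⟩ : ∃ g : Fin m → Fin q → ℝ, g = fun a (y : Fin q) =>
          if (y : ℕ) = 0 then (if a ∈ Op z M then (1/2)/b else 1)
            else (if a ∈ Op z M then 1/b else 1) := ⟨_, rfl⟩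
      have e : (fun x => X z (Function.update M z x)) = fun x : Fin m → Fin q =>
          ∏ a, g a (x a) := by
        funext x
        rw [hg]
        simp only [hX]
        rw [hOp z (Function.update M z x) M (fun y hy => by simp [hy.ne])]
        rw [← prod_subset (subset_univ (Op z M))]
        · apply prod_congr rfl
          intro a ha
          simp only [Function.update_self, ha, if_true]
          split_ifs <;> rfl
        · intro a _ ha
          simp [ha]
      rw [e]
      refine le_of_eq ((av_pi g).trans ?_)
      apply prod_eq_one
      intro a _
      rw [hg]
      simp only []
      rw [av_bit q hq]
      split_ifs
      · have e2 : 1 / b + ((1/2) / b - 1 / b) / (q:ℝ) = (1 - 1 / (2 * q : ℝ)) / b := by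
          field_simp; ring
        rw [e2, ← hb, div_self hb0.ne']
      · simp
  have hc : 0 < (1/2 : ℝ) ^ j / b ^ T := by positivity
  refine (pr_markov (f := fun M => ∏ z, X z M) hc ?_ ?_).trans ?_
  · intro M; apply prod_nonneg; intro z _; rw [hXval]; positivity
  · rintro M ⟨h1, h2⟩
    simp only [hXval]
    rw [prod_div_distrib, prod_pow_eq_pow_sum, prod_pow_eq_pow_sum]
    apply div_le_div₀ (by positivity)
    · exact pow_le_pow_of_le_one (by norm_num) (by norm_num) h2.le
    · positivity
    · exact pow_le_pow_of_le_one hb0.le hb1 h1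
  · calc _ ≤ 1 / ((1/2 : ℝ) ^ j / b ^ T) := div_le_div_of_nonneg_right key hc.le
      _ = _ := by rw [one_div_pow]; field_simp

/-- Bit predicate: symmetric closure relation. -/
def nb {m q : ℕ} (M : Fin m → Fin m → Fin q) (z a : Fin m) : Prop :=
  (M z a : ℕ) = 0 ∨ (M a z : ℕ) = 0

def cl {m q : ℕ} (M : Fin m → Fin m → Fin q) (a a' : Fin m) : Prop :=
  ∃ z, nb M z a ∧ nb M z a'

def cls {m q : ℕ} (M : Fin m → Fin m → Fin q) (a a' : Fin m) : Prop :=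
  ∃ z, z < a ∧ z < a' ∧ (M z a : ℕ) = 0 ∧ (M z a' : ℕ) = 0

def lk {m q : ℕ} (M : Fin m → Fin m → Fin q) (a a' : Fin m) : Prop :=
  (a < a' ∧ (M a a' : ℕ) = 0) ∨ (a' < a ∧ (M a' a : ℕ) = 0)

section gr
variable {m q : ℕ} {V : Type*}

def good (M M' : Fin m → Fin m → Fin q) (p p' : V → Fin m) (x y : V) : Prop :=
  lk M (p x) (p y) ∧ ¬ cls M (p x) (p y) ∧ ¬ cl M' (p' x) (p' y)

theorem lk_symm {M : Fin m → Fin m → Fin q} {a a' : Fin m} (h : lk M a a') : lk M a' a := by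
  unfold lk at *; tauto
theorem cl_symm {M : Fin m → Fin m → Fin q} {a a' : Fin m} (h : cl M a a') : cl M a' a := by
  obtain ⟨z, h1, h2⟩ := h; exact ⟨z, h2, h1⟩
theorem cls_symm {M : Fin m → Fin m → Fin q} {a a' : Fin m} (h : cls M a a') : cls M a' a := by
  obtain ⟨z, h1, h2, h3, h4⟩ := h; exact ⟨z, h2, h1, h4, h3⟩
theorem good_symm {M M' : Fin m → Fin m → Fin q} {p p' : V → Fin m} {x y : V}
    (h : good M M' p p' x y) : good M M' p p' y x :=
  ⟨lk_symm h.1, fun h' => h.2.1 (cls_symm h'), fun h' => h.2.2 (cl_symm h')⟩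
theorem lk_nb {M : Fin m → Fin m → Fin q} {a a' : Fin m} (h : lk M a a') : nb M a a' := by
  unfold lk nb at *; tauto
theorem lk_irrefl {M : Fin m → Fin m → Fin q} {a : Fin m} : ¬ lk M a a := by
  unfold lk; simp

theorem lk_tri {M : Fin m → Fin m → Fin q} {a b c : Fin m} (h1 : lk M a b) (h2 : lk M a c)
    (h3 : lk M b c) : cls M a b ∨ cls M a c ∨ cls M b c := by
  unfold lk at *
  have main : ∀ a b c : Fin m, a < b → a < c → ((M a b : ℕ) = 0) → ((M a c : ℕ) = 0) → cls M b c :=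
    fun a b c h1 h2 h3 h4 => ⟨a, h1, h2, h3, h4⟩
  rcases h1 with ⟨h1, k1⟩ | ⟨h1, k1⟩ <;> rcases h2 with ⟨h2, k2⟩ | ⟨h2, k2⟩ <;>
    rcases h3 with ⟨h3, k3⟩ | ⟨h3, k3⟩
  · exact .inr (.inr (main _ _ _ h1 h2 k1 k2))
  · exact .inr (.inr (main _ _ _ h1 h2 k1 k2))
  · exact absurd (h1.trans h3) (not_lt.2 h2.le)
  · exact .inl (main _ _ _ h2 h3 k2 k3)
  · exact .inr (.inl (main _ _ _ h1 h3 k1 k3))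
  · exact absurd (h1.trans h2) (not_lt.2 h3.le)
  · exact .inr (.inl (main _ _ _ h1 h3 k1 k3))
  · exact .inl (main _ _ _ h2 h3 k2 k3)

/-- The two coloured graph. -/
def twoG (M M' : Fin m → Fin m → Fin q) (p p' : V → Fin m) : SimpleGraph V where
  Adj x y := good M M' p p' x y ∨ good M' M p' p x y
  symm := ⟨by
    intro x y h
    rcases h with h | h
    · exact .inl (good_symm h)
    · exact .inr (good_symm h)⟩
  loopless := ⟨by
    intro x h
    rcases h with h | h
    · exact lk_irrefl h.1
    · exact lk_irrefl h.1⟩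

theorem twoG_tf (M M' : Fin m → Fin m → Fin q) (p p' : V → Fin m) (x y z : V)
    (h1 : (twoG M M' p p').Adj x y) (h2 : (twoG M M' p p').Adj x z) :
    ¬ (twoG M M' p p').Adj y z := by
  intro h3
  have mono : ∀ (M M' : Fin m → Fin m → Fin q) (p p' : V → Fin m) (x y z : V),
      good M M' p p' x y → good M M' p p' x z → good M M' p p' y z → False := by
    intro M M' p p' x y z h1 h2 h3
    rcases lk_tri h1.1 h2.1 h3.1 with h | h | h
    · exact h1.2.1 h
    · exact h2.2.1 h
    · exact h3.2.1 h
  have mix : ∀ (M M' : Fin m → Fin m → Fin q) (p p' : V → Fin m) (x y z : V),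
      good M M' p p' x y → good M M' p p' x z → good M' M p' p y z → False := by
    intro M M' p p' x y z h1 h2 h3
    exact h3.2.2 ⟨p x, lk_nb h1.1, lk_nb h2.1⟩
  rcases h1 with h1 | h1 <;> rcases h2 with h2 | h2 <;> rcases h3 with h3 | h3
  · exact mono _ _ _ _ _ _ _ h1 h2 h3
  · exact mix _ _ _ _ _ _ _ h1 h2 h3
  · exact mix _ _ _ _ _ _ _ (good_symm h1) h3 h2
  · exact mix _ _ _ _ _ _ _ (good_symm h2) (good_symm h3) h1
  · exact mix _ _ _ _ _ _ _ (good_symm h2) (good_symm h3) h1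
  · exact mix _ _ _ _ _ _ _ (good_symm h1) h3 h2
  · exact mix _ _ _ _ _ _ _ h1 h2 h3
  · exact mono _ _ _ _ _ _ _ h1 h2 h3

end gr

theorem qmult (m q N : ℕ) (B : Fin m → Fin m → Prop) [DecidableRel B]
    (hB : ∀ S : Finset (Fin m), S.card ≤ q → 64 * ∑ z, (S.filter (fun a => B z a)).card ^ 2 ≤ q ^ 2)
    (F : Fin (q * N) → Fin m) (hF : ∀ a, (univ.filter (fun i => F i = a)).card ≤ N) :
    64 * ∑ z, (univ.filter (fun i => B z (F i))).card ^ 2 ≤ (q * N) ^ 2 := by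
  classical
  set σ := Tuple.sort F with hσ
  have hmono : Monotone (F ∘ σ) := Tuple.monotone_sort F
  have hfib : ∀ a, (univ.filter (fun i => (F ∘ σ) i = a)).card ≤ N := by
    intro a
    refine le_trans (le_of_eq ?_) (hF a)
    apply card_bij (fun i _ => σ i)
    · intro i hi; simpa using hi
    · intro i _ i' _ h; exact σ.injective h
    · intro b hb; exact ⟨σ.symm b, by simpa using hb, by simp⟩
  have hinj : ∀ c : Fin N, Function.Injective (fun u : Fin q => F (σ (finProdFinEquiv (u, c)))) := by
    intro c
    have main : ∀ u u' : Fin q, u < u' → F (σ (finProdFinEquiv (u, c))) ≠ F (σ (finProdFinEquiv (u', c))) := by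
      intro u u' huu heq
      have hsub : Finset.Icc (finProdFinEquiv (u, c)) (finProdFinEquiv (u', c)) ⊆
          univ.filter (fun i => (F ∘ σ) i = F (σ (finProdFinEquiv (u, c)))) := by
        intro i hi
        rw [Finset.mem_Icc] at hi
        simp only [mem_filter, mem_univ, true_and]
        apply le_antisymm
        · rw [heq]; exact hmono hi.2
        · exact hmono hi.1
      have h1 := (card_le_card hsub).trans (hfib _)
      rw [Fin.card_Icc] at h1
      simp only [finProdFinEquiv_apply_val] at h1
      have h2 : N * ((u:ℕ) + 1) ≤ N * (u' : ℕ) := Nat.mul_le_mul_left _ huu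
      rw [Nat.mul_add] at h2
      omega
    intro u u' h
    rcases lt_trichotomy u u' with h1 | h1 | h1
    · exact absurd h (main u u' h1)
    · exact h1
    · exact absurd h.symm (main u' u h1)
  set S : Fin N → Finset (Fin m) := fun c => univ.image (fun u : Fin q => F (σ (finProdFinEquiv (u, c))))
    with hS
  have hScard : ∀ c, (S c).card ≤ q := fun c => card_image_le.trans (by simp)
  have hcount : ∀ z, (univ.filter (fun i => B z (F i))).card = ∑ c, ((S c).filter (fun a => B z a)).card := by
    intro z
    have e1 : ∀ c, ((S c).filter (fun a => B z a)).card =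
        ∑ u : Fin q, if B z (F (σ (finProdFinEquiv (u, c)))) then 1 else 0 := by
      intro c
      rw [hS, filter_image, card_image_of_injective _ (hinj c), card_filter]
    simp_rw [e1]
    rw [sum_comm, ← Fintype.sum_prod_type' (f := fun (u : Fin q) (c : Fin N) => if B z (F (σ (finProdFinEquiv (u, c)))) then 1 else 0)]
    rw [Equiv.sum_comp finProdFinEquiv (fun i => if B z (F (σ i)) then 1 else 0),
      Equiv.sum_comp σ (fun i => if B z (F i) then 1 else 0), card_filter]
  calc 64 * ∑ z, (univ.filter (fun i => B z (F i))).card ^ 2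
      = 64 * ∑ z, (∑ c, ((S c).filter (fun a => B z a)).card) ^ 2 := by simp_rw [hcount]
    _ ≤ 64 * ∑ z, (N * ∑ c, ((S c).filter (fun a => B z a)).card ^ 2) := by
        gcongr with z _
        have := sq_sum_le_card_mul_sum_sq (s := (univ : Finset (Fin N))) (f := fun c => ((S c).filter (fun a => B z a)).card)
        simpa using this
    _ = N * ∑ c, (64 * ∑ z, ((S c).filter (fun a => B z a)).card ^ 2) := by
        rw [← mul_sum, ← mul_sum, sum_comm]; ring
    _ ≤ N * ∑ _c : Fin N, q ^ 2 := by
        gcongr with c _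
        exact hB (S c) (hScard c)
    _ = (q * N) ^ 2 := by simp; ring

theorem closed_le {ι κ : Type*} [Fintype ι] [Fintype κ] [DecidableEq ι] [DecidableEq κ] (B : κ → ι → Prop) [∀ z i, Decidable (B z i)]
    [DecidablePred (fun p : ι × ι => ∃ z, B z p.1 ∧ B z p.2)] :
    (univ.filter (fun p : ι × ι => ∃ z, B z p.1 ∧ B z p.2)).card ≤
      ∑ z, (univ.filter (fun i => B z i)).card ^ 2 := by
  have : univ.filter (fun p : ι × ι => ∃ z, B z p.1 ∧ B z p.2) ⊆
      univ.biUnion (fun z => (univ.filter (fun i => B z i)) ×ˢ (univ.filter (fun i => B z i))) := by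
    intro p hp
    simpa using hp
  refine (card_le_card this).trans (card_biUnion_le.trans ?_)
  apply sum_le_sum; intro z _
  rw [card_product, sq]

/-- Niceness of a matrix. -/
def nice (m q : ℕ) (M : Fin m → Fin m → Fin q) : Prop :=
  ∀ S : Finset (Fin m), S.card ≤ q → 64 * ∑ z, (S.filter (fun a => (M z a : ℕ) = 0)).card ^ 2 ≤ q ^ 2

/-- Number of closed pairs. -/
theorem cls_le (m q N : ℕ) (M : Fin m → Fin m → Fin q) (hM : nice m q M)
    (F : Fin (q * N) → Fin m) (hF : ∀ a, (univ.filter (fun i => F i = a)).card ≤ N)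
    [DecidablePred (fun p : Fin (q * N) × Fin (q * N) => cls M (F p.1) (F p.2))] :
    64 * (univ.filter (fun p : Fin (q * N) × Fin (q * N) => cls M (F p.1) (F p.2))).card ≤ (q * N) ^ 2 := by
  classical
  have h1 := qmult m q N (fun z a => (M z a : ℕ) = 0) hM F hF
  have h2 := closed_le (fun (z : Fin m) (i : Fin (q * N)) => (M z (F i) : ℕ) = 0)
  have h3 : (univ.filter (fun p : Fin (q * N) × Fin (q * N) => cls M (F p.1) (F p.2))).card ≤
      (univ.filter (fun p : Fin (q * N) × Fin (q * N) => ∃ z, (M z (F p.1) : ℕ) = 0 ∧ (M z (F p.2) : ℕ) = 0)).card := by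
    apply card_le_card
    intro p hp
    simp only [mem_filter, mem_univ, true_and] at hp ⊢
    obtain ⟨z, _, _, h3, h4⟩ := hp
    exact ⟨z, h3, h4⟩
  exact (Nat.mul_le_mul_left 64 (h3.trans h2)).trans h1

theorem cl_le (m q N : ℕ) (M : Fin m → Fin m → Fin q) (hM : nice m q M)
    (hM' : nice m q (fun a z => M z a))
    (F : Fin (q * N) → Fin m) (hF : ∀ a, (univ.filter (fun i => F i = a)).card ≤ N)
    [DecidablePred (fun p : Fin (q * N) × Fin (q * N) => cl M (F p.1) (F p.2))] :
    64 * (univ.filter (fun p : Fin (q * N) × Fin (q * N) => cl M (F p.1) (F p.2))).card ≤ 4 * (q * N) ^ 2 := by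
  classical
  have h1 := qmult m q N (fun z a => (M z a : ℕ) = 0) hM F hF
  have h1' := qmult m q N (fun z a => (M a z : ℕ) = 0) hM' F hF
  have h2 := closed_le (fun (z : Fin m) (i : Fin (q * N)) => nb M z (F i))
  have h3 : ∀ z, (univ.filter (fun i => nb M z (F i))).card ^ 2 ≤
      2 * (univ.filter (fun i => (M z (F i) : ℕ) = 0)).card ^ 2 + 2 * (univ.filter (fun i => (M (F i) z : ℕ) = 0)).card ^ 2 := by
    intro z
    have : (univ.filter (fun i => nb M z (F i))).card ≤
      (univ.filter (fun i => (M z (F i) : ℕ) = 0)).card + (univ.filter (fun i => (M (F i) z : ℕ) = 0)).card := by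
      refine le_trans (card_le_card ?_) (card_union_le _ _)
      intro i hi
      simp only [mem_union, mem_filter, mem_univ, true_and] at hi ⊢
      exact hi
    calc _ ≤ ((univ.filter (fun i => (M z (F i) : ℕ) = 0)).card + (univ.filter (fun i => (M (F i) z : ℕ) = 0)).card)^2 :=
          Nat.pow_le_pow_left this 2
      _ ≤ _ := by
          generalize (univ.filter (fun i => (M z (F i) : ℕ) = 0)).card = u
          generalize (univ.filter (fun i => (M (F i) z : ℕ) = 0)).card = v
          zify
          nlinarith [sq_nonneg ((u : ℤ) - v)]
  have h4 : ∑ z, (univ.filter (fun i => nb M z (F i))).card ^ 2 ≤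
    2 * ∑ z, (univ.filter (fun i => (M z (F i) : ℕ) = 0)).card ^ 2 + 2 * ∑ z, (univ.filter (fun i => (M (F i) z : ℕ) = 0)).card ^ 2 := by
    rw [mul_sum, mul_sum, ← sum_add_distrib]
    exact sum_le_sum fun z _ => h3 z
  have h5 : (univ.filter (fun p : Fin (q * N) × Fin (q * N) => cl M (F p.1) (F p.2))).card ≤
      ∑ z, (univ.filter (fun i => nb M z (F i))).card ^ 2 := by
    convert h2 using 2
    ext p; simp only [mem_filter, mem_univ, true_and]; rfl
  omega

/-- Number of increasing pairs. -/
theorem incr_pairs {h m : ℕ} (F : Fin h → Fin m) (hF : Function.Injective F) :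
    2 * (univ.filter (fun p : Fin h × Fin h => F p.1 < F p.2)).card + h = h ^ 2 := by
  have e1 : (univ.filter (fun p : Fin h × Fin h => F p.2 < F p.1)).card =
      (univ.filter (fun p : Fin h × Fin h => F p.1 < F p.2)).card := by
    apply card_bij (fun p _ => (p.2, p.1))
    · intro p hp; simpa using hp
    · rintro ⟨a, b⟩ _ ⟨c, d⟩ _ h; simp at h; simp [h]
    · rintro ⟨a, b⟩ hp; exact ⟨(b, a), by simpa using hp, rfl⟩
  have e2 : (univ.filter (fun p : Fin h × Fin h => F p.1 = F p.2)).card = h := by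
    have : univ.filter (fun p : Fin h × Fin h => F p.1 = F p.2) = univ.image (fun i : Fin h => (i, i)) := by
      ext ⟨a, b⟩; simp [hF.eq_iff]
    rw [this, card_image_of_injective _ (fun a b h => by simpa using h)]; simp
  have e3 : (univ : Finset (Fin h × Fin h)) = (univ.filter (fun p : Fin h × Fin h => F p.1 < F p.2)) ∪
     ((univ.filter (fun p : Fin h × Fin h => F p.2 < F p.1)) ∪ (univ.filter (fun p : Fin h × Fin h => F p.1 = F p.2))) := by
    ext p
    simp only [mem_union, mem_filter, mem_univ, true_and, true_iff]
    rcases lt_trichotomy (F p.1) (F p.2) with h | h | h <;> simp [h]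
  have e4 := congrArg card e3
  rw [card_union_of_disjoint, card_union_of_disjoint] at e4
  · simp only [card_univ, Fintype.card_prod, Fintype.card_fin] at e4
    rw [sq, e4]; omega
  · rw [disjoint_filter]; intro p _ h1 h2; exact absurd h2 h1.ne'
  · rw [disjoint_union_right]
    constructor
    · rw [disjoint_filter]; intro p _ h1 h2; exact absurd h2 (not_lt.2 h1.le)
    · rw [disjoint_filter]; intro p _ h1 h2; exact absurd h2 h1.ne

open Classical in
theorem many_edges_g {V : Type*} [Fintype V] (m q N : ℕ) (hq : 1 ≤ q) (p p' : V → Fin m)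
    (hp' : ∀ a, (univ.filter (fun x => p' x = a)).card ≤ N)
    (M' : Fin m → Fin m → Fin q) (hM1 : nice m q M') (hM2 : nice m q (fun a z => M' z a))
    (g : Fin (q * N) → V) (hg : Function.Injective (fun i => p (g i)))
    (hN : 1 ≤ N)
    (T j : ℕ) (hT : 128 * T + 10 * (q * N) ^ 2 + 64 * (q * N) ≤ 64 * (q * N) ^ 2) :
    pr (fun M : Fin m → Fin m → Fin q => nice m q M ∧
      (univ.filter (fun s : Fin (q * N) × Fin (q * N) => good M M' p p' (g s.1) (g s.2))).card < j) ≤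
      2 ^ j * (1 - 1 / (2 * q : ℝ)) ^ T := by
  set Op : Fin m → (Fin m → Fin m → Fin q) → Finset (Fin m) := fun z M =>
    univ.filter (fun a' => ∃ i i', p (g i) = z ∧ p (g i') = a' ∧ z < a' ∧ ¬ cls M z a' ∧
      ¬ cl M' (p' (g i)) (p' (g i'))) with hOpdef
  have hOp : ∀ z M M', (∀ y < z, M y = M' y) → Op z M = Op z M' := by
    intro z M M'' h
    have hc : ∀ a', cls M z a' ↔ cls M'' z a' := by
      intro a'
      unfold cls
      constructor
      · rintro ⟨y, h1, h2, h3, h4⟩; refine ⟨y, h1, h2, ?_, ?_⟩ <;> rw [← h y h1] <;> assumption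
      · rintro ⟨y, h1, h2, h3, h4⟩; refine ⟨y, h1, h2, ?_, ?_⟩ <;> rw [h y h1] <;> assumption
    simp only [hOpdef, hc]
  refine (pr_mono ?_).trans (exposure m q hq Op hOp T j)
  rintro M ⟨hM, hlt⟩
  have ginj : Function.Injective g := fun a b h => hg (by simp [h])
  set φ : Fin (q * N) × Fin (q * N) → (_ : Fin m) × Fin m := fun s => ⟨p (g s.1), p (g s.2)⟩ with hφ
  have hφinj : Function.Injective φ := by
    rintro ⟨a, b⟩ ⟨c, d⟩ h
    simp only [hφ, Sigma.mk.injEq, heq_eq_eq] at h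
    exact Prod.ext (hg h.1) (hg h.2)
  constructor
  · have c1 := cls_le m q N M hM (fun i => p (g i)) (fun a => by
      refine le_trans (card_le_one.2 ?_) hN
      intro x hx y hy
      simp only [mem_filter, mem_univ, true_and] at hx hy
      exact hg (hx.trans hy.symm))
    have c2 := cl_le m q N M' hM1 hM2 (fun i => p' (g i)) (fun a => by
      refine le_trans ?_ (hp' a)
      apply card_le_card_of_injOn g
      · intro i hi; simpa using hi
      · exact ginj.injOn)
    have c3 := incr_pairs (fun i => p (g i)) hg
    set A := univ.filter (fun s : Fin (q * N) × Fin (q * N) => p (g s.1) < p (g s.2)) with hA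
    set B := univ.filter (fun s : Fin (q * N) × Fin (q * N) => cls M (p (g s.1)) (p (g s.2))) with hB
    set C := univ.filter (fun s : Fin (q * N) × Fin (q * N) => cl M' (p' (g s.1)) (p' (g s.2))) with hC
    have c4 : (A \ (B ∪ C)).card ≤ ∑ z, (Op z M).card := by
      rw [← card_sigma]
      apply card_le_card_of_injOn φ
      · intro s hs
        rw [mem_coe] at hs
        simp only [hA, hB, hC, mem_sdiff, mem_filter, mem_univ, true_and, mem_union, not_or] at hs
        rw [mem_coe, mem_sigma]
        simp only [hφ, hOpdef, mem_univ, mem_filter, true_and]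
        exact ⟨s.1, s.2, rfl, rfl, hs⟩
      · exact hφinj.injOn
    have c5 : A.card ≤ (A \ (B ∪ C)).card + (B ∪ C).card := by
      have := card_le_card_sdiff_add_card (s := A) (t := B ∪ C)
      omega
    have c6 := card_union_le B C
    omega
  · refine lt_of_le_of_lt ?_ hlt
    rw [← card_sigma]
    rw [← card_image_of_injective (univ.filter (fun s : Fin (q * N) × Fin (q * N) => good M M' p p' (g s.1) (g s.2))) hφinj]
    apply card_le_card
    rintro ⟨z, a⟩ h
    simp only [mem_sigma, mem_univ, true_and, hOpdef, mem_filter] at h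
    obtain ⟨⟨i, i', h1, h2, h3, h4, h5⟩, h6⟩ := h
    rw [mem_image]
    refine ⟨(i, i'), ?_, by simp [hφ, h1, h2]⟩
    simp only [mem_filter, mem_univ, true_and]
    subst h1; subst h2
    exact ⟨.inl ⟨h3, h6⟩, h4, h5⟩

open Classical in
theorem many_edges {V : Type*} [Fintype V] (m q N : ℕ) (hq : 1 ≤ q) (hN : 1 ≤ N) (p p' : V → Fin m)
    (hp' : ∀ a, (univ.filter (fun x => p' x = a)).card ≤ N)
    (M' : Fin m → Fin m → Fin q) (hM1 : nice m q M') (hM2 : nice m q (fun a z => M' z a))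
    (T j : ℕ) (hT : 128 * T + 10 * (q * N) ^ 2 + 64 * (q * N) ≤ 64 * (q * N) ^ 2) :
    pr (fun M : Fin m → Fin m → Fin q => nice m q M ∧ ∃ I : Finset V, q * N ≤ (I.image p).card ∧
      ((I ×ˢ I).filter (fun s => good M M' p p' s.1 s.2)).card < j) ≤
      (Fintype.card V : ℝ) ^ (q * N) * (2 ^ j * (1 - 1 / (2 * q : ℝ)) ^ T) := by
  have hnn : (0:ℝ) ≤ 2 ^ j * (1 - 1 / (2 * q : ℝ)) ^ T := by
    have hq' : (1:ℝ) ≤ q := by exact_mod_cast hq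
    have : 1 / (2 * q : ℝ) ≤ 1 := by rw [div_le_one (by linarith)]; linarith
    have : 0 ≤ 1 - 1 / (2 * q : ℝ) := by linarith
    positivity
  have h1 := pr_exists_le (fun (g : Fin (q * N) → V) (M : Fin m → Fin m → Fin q) =>
    Function.Injective (fun i => p (g i)) ∧ (nice m q M ∧
      (univ.filter (fun s : Fin (q * N) × Fin (q * N) => good M M' p p' (g s.1) (g s.2))).card < j))
    _ (fun g => by
      by_cases hg : Function.Injective (fun i => p (g i))
      · exact (pr_mono fun M h => h.2).trans (many_edges_g m q N hq p p' hp' M' hM1 hM2 g hg hN T j hT)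
      · refine le_trans (le_of_eq ?_) hnn
        simp only [hg, false_and]
        unfold pr; simp [av])
  simp only [Fintype.card_fun, Fintype.card_fin, Nat.cast_pow] at h1
  refine (pr_mono ?_).trans h1
  rintro M ⟨hM, I, hI, hj⟩
  obtain ⟨S, hS1, hS2⟩ := exists_subset_card_eq hI
  have hch : ∀ a : S, ∃ x ∈ I, p x = a := by
    rintro ⟨a, ha⟩
    have := hS1 ha
    rw [mem_image] at this
    exact this
  choose f hf1 hf2 using hch
  let e : Fin (q * N) ≃ S := (Finset.equivFinOfCardEq hS2).symm
  have hinj : Function.Injective (fun i => p (f (e i))) := by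
    intro a b hab
    simp only [hf2] at hab
    exact e.injective (Subtype.ext hab)
  refine ⟨fun i => f (e i), hinj, hM, lt_of_le_of_lt ?_ hj⟩
  apply card_le_card_of_injOn (fun s => (f (e s.1), f (e s.2)))
  · intro s hs
    simp only [coe_filter, mem_univ, true_and, Set.mem_ofPred_eq] at hs
    simp only [coe_filter, mem_product, Set.mem_ofPred_eq]
    exact ⟨⟨hf1 _, hf1 _⟩, hs⟩
  · rintro ⟨a, b⟩ _ ⟨c, d⟩ _ h
    simp only [Prod.mk.injEq] at h
    exact Prod.ext (hinj (by simp [h.1])) (hinj (by simp [h.2]))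

theorem pr_false {Ω : Type*} [Fintype Ω] {P : Ω → Prop} (h : ∀ x, ¬ P x) : pr P = 0 := by
  unfold pr; simp [av, h]

/-- Transposition as an equivalence. -/
def transp (m q : ℕ) : (Fin m → Fin m → Fin q) ≃ (Fin m → Fin m → Fin q) where
  toFun M := fun a z => M z a
  invFun M := fun a z => M z a
  left_inv _ := rfl
  right_inv _ := rfl

open Classical in
theorem combine {V : Type*} [Fintype V] (m q N : ℕ) (hq : 1 ≤ q) (hN : 1 ≤ N) (p p' : V → Fin m)
    (hp : ∀ a, (univ.filter (fun x => p x = a)).card ≤ N)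
    (hp' : ∀ a, (univ.filter (fun x => p' x = a)).card ≤ N)
    (T j : ℕ) (hT : 128 * T + 10 * (q * N) ^ 2 + 64 * (q * N) ≤ 64 * (q * N) ^ 2)
    (hnice : pr (fun M => ¬ nice m q M) ≤ 1 / 16)
    (hsmall : (Fintype.card V : ℝ) ^ (q * N) * (2 ^ j * (1 - 1 / (2 * q : ℝ)) ^ T) ≤ 1 / 4) :
    ∃ G : SimpleGraph V, (∀ x y z, G.Adj x y → G.Adj x z → ¬ G.Adj y z) ∧
      ∀ I : Finset V, (q * N ≤ (I.image p).card ∨ q * N ≤ (I.image p').card) →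
        j ≤ ((I ×ˢ I).filter (fun s => G.Adj s.1 s.2)).card := by
  have : NeZero q := ⟨by omega⟩
  have hniceT : pr (fun M : Fin m → Fin m → Fin q => ¬ nice m q (fun a z => M z a)) ≤ 1 / 16 := by
    have := pr_equiv (transp m q) (fun M => ¬ nice m q M)
    exact (le_of_eq this).trans hnice
  have hb : pr (fun M : Fin m → Fin m → Fin q => ¬ nice m q M ∨ ¬ nice m q (fun a z => M z a)) ≤ 1 / 8 := by
    refine pr_or.trans ?_; linarith
  set bad : (p p' : V → Fin m) → (M M' : Fin m → Fin m → Fin q) → Prop := fun p p' M M' =>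
    nice m q M' ∧ nice m q (fun a z => M' z a) ∧ nice m q M ∧ ∃ I : Finset V, q * N ≤ (I.image p).card ∧
      ((I ×ˢ I).filter (fun s => good M M' p p' s.1 s.2)).card < j with hbad
  have hbb : ∀ (p p' : V → Fin m) (_ : ∀ a, (univ.filter (fun x => p' x = a)).card ≤ N) (M' : Fin m → Fin m → Fin q),
      pr (fun M => bad p p' M M') ≤ 1 / 4 := by
    intro p p' hp' M'
    by_cases h1 : nice m q M' ∧ nice m q (fun a z => M' z a)
    · refine (pr_mono ?_).trans ((many_edges m q N hq hN p p' hp' M' h1.1 h1.2 T j hT).trans hsmall)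
      intro M hM; exact hM.2.2
    · rw [pr_false]
      · norm_num
      · intro M hM; exact h1 ⟨hM.1, hM.2.1⟩
  have htot : pr (fun ω : (Fin m → Fin m → Fin q) × (Fin m → Fin m → Fin q) =>
      ((¬ nice m q ω.1 ∨ ¬ nice m q (fun a z => ω.1 z a)) ∨ (¬ nice m q ω.2 ∨ ¬ nice m q (fun a z => ω.2 z a))) ∨
      (bad p p' ω.1 ω.2 ∨ bad p' p ω.2 ω.1)) < 1 := by
    refine lt_of_le_of_lt pr_or ?_
    have e1 := pr_or (P := fun ω : (Fin m → Fin m → Fin q) × (Fin m → Fin m → Fin q) => ¬ nice m q ω.1 ∨ ¬ nice m q (fun a z => ω.1 z a))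
      (Q := fun ω => ¬ nice m q ω.2 ∨ ¬ nice m q (fun a z => ω.2 z a))
    have e2 := pr_or (P := fun ω : (Fin m → Fin m → Fin q) × (Fin m → Fin m → Fin q) => bad p p' ω.1 ω.2)
      (Q := fun ω => bad p' p ω.2 ω.1)
    have f1 := pr_prod_le' (fun ω : (Fin m → Fin m → Fin q) × (Fin m → Fin m → Fin q) => ¬ nice m q ω.1 ∨ ¬ nice m q (fun a z => ω.1 z a))
      _ (fun _ => hb)
    have f2 := pr_prod_le (fun ω : (Fin m → Fin m → Fin q) × (Fin m → Fin m → Fin q) => ¬ nice m q ω.2 ∨ ¬ nice m q (fun a z => ω.2 z a))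
      _ (fun _ => hb)
    have f3 := pr_prod_le' (fun ω : (Fin m → Fin m → Fin q) × (Fin m → Fin m → Fin q) => bad p p' ω.1 ω.2)
      _ (hbb p p' hp')
    have f4 := pr_prod_le (fun ω : (Fin m → Fin m → Fin q) × (Fin m → Fin m → Fin q) => bad p' p ω.2 ω.1)
      _ (hbb p' p hp)
    linarith
  obtain ⟨⟨M, M'⟩, hω⟩ := exists_of_pr htot
  push Not at hω
  obtain ⟨⟨⟨h1, h2⟩, h3, h4⟩, h5, h6⟩ := hω
  simp only [hbad, not_and, not_exists, not_lt] at h5 h6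
  refine ⟨twoG M M' p p', twoG_tf M M' p p', ?_⟩
  rintro I (hI | hI)
  · refine (h5 h3 h4 h1 I hI).trans (card_le_card ?_)
    intro s hs
    rw [mem_filter] at hs ⊢
    exact ⟨hs.1, .inl hs.2⟩
  · refine (h6 h1 h2 h3 I hI).trans (card_le_card ?_)
    intro s hs
    rw [mem_filter] at hs ⊢
    exact ⟨hs.1, .inr hs.2⟩

theorem pr_coord {ι α : Type*} [Fintype ι] [DecidableEq ι] [Fintype α] [Nonempty α] (P : α → Prop) (z : ι) :
    pr (fun M : ι → α => P (M z)) = pr P := by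
  classical
  unfold pr
  obtain ⟨g, hg⟩ : ∃ g : ι → α → ℝ, g = fun y x => if y = z then (if P x then 1 else 0) else 1 := ⟨_, rfl⟩
  have e1 : (fun M : ι → α => if P (M z) then (1:ℝ) else 0) = fun M => ∏ y, g y (M y) := by
    funext M
    rw [hg]
    simp
  have e2 := av_pi g
  rw [← e1] at e2
  refine Eq.trans ?_ (e2.trans ?_)
  · congr
  rw [Fintype.prod_eq_single z]
  · rw [hg]; simp
  · intro y hy; rw [hg]; simp only [hy, if_false]; exact av_const 1

theorem av_pow_le (m q : ℕ) (hq : 1 ≤ q) (S : Finset (Fin m)) (y : ℝ) (hy : 1 ≤ y) :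
    av (fun x : Fin m → Fin q => y ^ (S.filter (fun a => (x a : ℕ) = 0)).card) ≤
      Real.exp ((y - 1) * S.card / q) := by
  obtain ⟨g, hg⟩ : ∃ g : Fin m → Fin q → ℝ, g = fun a (b : Fin q) =>
          if (b : ℕ) = 0 then (if a ∈ S then y else 1) else 1 := ⟨_, rfl⟩
  have e : (fun x : Fin m → Fin q => y ^ (S.filter (fun a => (x a : ℕ) = 0)).card) =
      fun x => ∏ a, g a (x a) := by
    funext x
    rw [hg, ← prod_const, prod_filter, ← prod_subset (subset_univ S)]
    · apply prod_congr rfl; intro a ha; simp [ha]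
    · intro a _ ha; simp [ha]
  rw [e]
  refine (av_pi g).le.trans ?_
  have e2 : ∀ a, av (g a) = if a ∈ S then 1 + (y - 1) / q else 1 := by
    intro a
    rw [hg]
    simp only []
    rw [av_bit q hq]
    split_ifs <;> simp
  simp only [e2]
  rw [prod_ite_mem, univ_inter, prod_const]
  have : 1 + (y - 1) / q ≤ Real.exp ((y - 1) / q) := by
    have := Real.add_one_le_exp ((y - 1) / q); linarith
  calc (1 + (y - 1) / q) ^ S.card ≤ (Real.exp ((y - 1) / q)) ^ S.card := by
        apply pow_le_pow_left₀ _ this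
        have : 0 ≤ (y - 1) / q := div_nonneg (by linarith) (by positivity)
        linarith
    _ = _ := by rw [← Real.exp_nat_mul]; congr 1; ring

theorem pointwise (D Δ d : ℕ) (hD : 1 ≤ D) (hY : Real.exp (Δ / D) ≤ D) :
    Real.exp ((min d Δ : ℕ) ^ 2 / D) ≤ 1 + 1 / D * 12 ^ d + (Real.exp (Δ / D) / D) ^ D * (D:ℝ) ^ d := by
  have hD' : (1:ℝ) ≤ D := by exact_mod_cast hD
  have hp1 : (0:ℝ) ≤ 1 / D * 12 ^ d := by positivity
  have hp2 : (0:ℝ) ≤ (Real.exp (Δ / D) / D) ^ D * (D:ℝ) ^ d := by positivity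
  by_cases h : d ≤ D
  · have hdD : (d:ℝ) ≤ D := by exact_mod_cast h
    set x : ℝ := (min d Δ : ℕ) ^ 2 / D with hx
    have hx0 : 0 ≤ x := by positivity
    have hmin : ((min d Δ : ℕ) : ℝ) ≤ d := by exact_mod_cast min_le_left _ _
    have hx1 : x ≤ d ^ 2 / D := by
      rw [hx]; gcongr
    have hx2 : x ≤ d := by
      refine hx1.trans ?_
      rw [div_le_iff₀ (by linarith), sq]
      gcongr
    have h1 : Real.exp x ≤ 1 + x * Real.exp x := by
      have := Real.add_one_le_exp (-x)
      rw [Real.exp_neg] at this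
      have hpos := Real.exp_pos x
      have h2 : (-x + 1) * Real.exp x ≤ 1 := by
        calc _ ≤ (Real.exp x)⁻¹ * Real.exp x := by gcongr
          _ = 1 := inv_mul_cancel₀ hpos.ne'
      linarith
    have h3 : (d:ℝ) ^ 2 ≤ 4 ^ d := by
      have : (d:ℝ) ≤ 2 ^ d := by exact_mod_cast Nat.lt_two_pow_self.le
      calc (d:ℝ) ^ 2 ≤ (2 ^ d) ^ 2 := by gcongr
        _ = 4 ^ d := by rw [← pow_mul, mul_comm, pow_mul]; norm_num
    have h4 : Real.exp x ≤ 3 ^ d := by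
      calc Real.exp x ≤ Real.exp (d * 1) := Real.exp_le_exp.2 (by linarith)
        _ = Real.exp 1 ^ d := Real.exp_nat_mul _ _
        _ ≤ 3 ^ d := by gcongr; linarith [Real.exp_one_lt_d9]
    have h5 : x * Real.exp x ≤ 1 / D * 12 ^ d := by
      calc x * Real.exp x ≤ (d ^ 2 / D) * 3 ^ d := by gcongr
        _ ≤ (4 ^ d / D) * 3 ^ d := by gcongr
        _ = 1 / D * 12 ^ d := by
          rw [show (12:ℝ) = 4 * 3 by norm_num, mul_pow]; ring
    linarith
  · push Not at h
    have hmin : ((min d Δ : ℕ) : ℝ) ≤ d := by exact_mod_cast min_le_left _ _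
    have hmin' : ((min d Δ : ℕ) : ℝ) ≤ Δ := by exact_mod_cast min_le_right _ _
    have h1 : Real.exp ((min d Δ : ℕ) ^ 2 / D) ≤ Real.exp (Δ / D) ^ d := by
      rw [← Real.exp_nat_mul]
      apply Real.exp_le_exp.2
      rw [← mul_div_assoc, sq]
      gcongr
    have h2 : Real.exp (Δ / D) ^ d ≤ (Real.exp (Δ / D) / D) ^ D * (D:ℝ) ^ d := by
      obtain ⟨k, rfl⟩ : ∃ k, d = D + k := ⟨d - D, by omega⟩
      rw [pow_add, pow_add, div_pow]
      have : Real.exp (Δ / D) ^ D / (D:ℝ) ^ D * ((D:ℝ) ^ D * (D:ℝ) ^ k) = Real.exp (Δ / D) ^ D * (D:ℝ) ^ k := by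
        field_simp
      rw [this]
      gcongr
    linarith

theorem row_mgf (m q : ℕ) (hq : 1 ≤ q) (S : Finset (Fin m)) (hS : S.card ≤ q) (D Δ : ℕ) (hD : 1 ≤ D)
    (hY : 2 * Real.exp 1 * Real.exp (Δ / D) ≤ D) :
    av (fun x : Fin m → Fin q => Real.exp ((min (S.filter (fun a => (x a : ℕ) = 0)).card Δ : ℕ) ^ 2 / D)) ≤
      Real.exp (60000 / D) := by
  have hD' : (1:ℝ) ≤ D := by exact_mod_cast hD
  have hq' : (1:ℝ) ≤ q := by exact_mod_cast hq
  have hS' : (S.card:ℝ) ≤ q := by exact_mod_cast hS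
  have hY0 := Real.exp_pos ((Δ:ℝ) / D)
  have he1 : (1:ℝ) ≤ Real.exp 1 := by have := Real.add_one_le_exp (1:ℝ); linarith
  have hY1 : Real.exp (Δ / D) ≤ D := by nlinarith
  have : Nonempty (Fin m → Fin q) := ⟨fun _ => ⟨0, by omega⟩⟩
  have hmono : ∀ y : ℝ, 1 ≤ y → av (fun x : Fin m → Fin q => y ^ (S.filter (fun a => (x a : ℕ) = 0)).card) ≤
      Real.exp (y - 1) := by
    intro y hy
    refine (av_pow_le m q hq S y hy).trans (Real.exp_le_exp.2 ?_)
    rw [div_le_iff₀ (by linarith)]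
    exact mul_le_mul_of_nonneg_left hS' (by linarith)
  refine (av_mono (fun x => pointwise D Δ _ hD hY1)).trans ?_
  rw [av_add, av_add, av_const, av_mul, av_mul]
  have h12 := hmono 12 (by norm_num)
  have hDD := hmono D hD'
  have he11 : Real.exp (12 - 1) ≤ 59999 := by
    rw [show (12 - 1 : ℝ) = (11 : ℕ) * 1 by norm_num, Real.exp_nat_mul]
    calc Real.exp 1 ^ 11 ≤ 2.7182818286 ^ 11 := by gcongr; exact Real.exp_one_lt_d9.le
      _ ≤ 59999 := by norm_num
  have hlast : (Real.exp (Δ / D) / D) ^ D * Real.exp (D - 1) ≤ 1 / D := by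
    calc (Real.exp (Δ / D) / D) ^ D * Real.exp (D - 1) ≤ (Real.exp (Δ / D) / D) ^ D * Real.exp 1 ^ D := by
          rw [← Real.exp_nat_mul]; gcongr; linarith
      _ = (Real.exp (Δ / D) / D * Real.exp 1) ^ D := by rw [mul_pow]
      _ ≤ (1/2) ^ D := by
          gcongr
          rw [div_mul_eq_mul_div, div_le_iff₀ (by linarith)]
          linarith
      _ ≤ 1 / D := by
          rw [one_div_pow]
          apply one_div_le_one_div_of_le (by linarith)
          exact_mod_cast Nat.lt_two_pow_self.le
  have hfin := Real.add_one_le_exp (60000 / (D:ℝ))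
  have ha : (1:ℝ) / D * av (fun x : Fin m → Fin q => (12:ℝ) ^ (S.filter (fun a => (x a : ℕ) = 0)).card) ≤ 1 / D * 59999 := by
    gcongr; exact h12.trans he11
  have hb : (Real.exp (Δ / D) / D) ^ D * av (fun x : Fin m → Fin q => (D:ℝ) ^ (S.filter (fun a => (x a : ℕ) = 0)).card) ≤ 1 / D :=
    (mul_le_mul_of_nonneg_left hDD (by positivity)).trans hlast
  have hc : 60000 / (D:ℝ) = 1 / D * 59999 + 1 / D := by ring
  linarith

theorem nice_prob (m q ℓ r D : ℕ) (hq : 1 ≤ q) (hD : 1 ≤ D) (hl : 2 ≤ ℓ) (hlr : ℓ ≤ r) (hm1 : 1 ≤ m)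
    (hm : (m:ℝ) ≤ Real.exp ℓ) (hmq : m ≤ q * r) (hE : 7680000 * m ≤ q ^ 2) (hqD : 256 * ℓ * D ≤ q)
    (hY : 2 * Real.exp 1 * Real.exp ((8 * r : ℕ) / D) ≤ D) :
    pr (fun M => ¬ nice m q M) ≤ 1 / 16 := by
  have hD' : (1:ℝ) ≤ D := by exact_mod_cast hD
  have hq' : (1:ℝ) ≤ q := by exact_mod_cast hq
  have hl' : (2:ℝ) ≤ ℓ := by exact_mod_cast hl
  have hlr' : (ℓ:ℝ) ≤ r := by exact_mod_cast hlr
  have hmq' : (m:ℝ) ≤ q * r := by exact_mod_cast hmq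
  have hE' : 7680000 * (m:ℝ) ≤ q ^ 2 := by exact_mod_cast hE
  have hqD' : 256 * (ℓ:ℝ) * D ≤ q := by exact_mod_cast hqD
  have hm0 : (0:ℝ) < m := by exact_mod_cast hm1
  have : Nonempty (Fin m → Fin q) := ⟨fun _ => ⟨0, by omega⟩⟩
  set Δ := 8 * r with hΔ
  -- event A
  have hA : pr (fun M : Fin m → Fin m → Fin q => ∃ z, Δ < (univ.filter (fun a => (M z a : ℕ) = 0)).card) ≤ 1 / 32 := by
    have h1 : ∀ z : Fin m, pr (fun M : Fin m → Fin m → Fin q => Δ < (univ.filter (fun a => (M z a : ℕ) = 0)).card) ≤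
        Real.exp (-4 * r) := by
      intro z
      have hpr : pr (fun x : Fin m → Fin q => Δ < (univ.filter (fun a => (x a : ℕ) = 0)).card) ≤ Real.exp (-4 * r) := by
        refine (pr_markov (f := fun x : Fin m → Fin q => (2:ℝ) ^ (univ.filter (fun a => (x a : ℕ) = 0)).card)
          (c := 2 ^ Δ) (by positivity) (fun x => by positivity) (fun x hx => ?_)).trans ?_
        · exact pow_le_pow_right₀ (by norm_num) hx.le
        · have h2 := av_pow_le m q hq univ 2 (by norm_num)
          have h3 : Real.exp ((2 - 1) * (univ : Finset (Fin m)).card / q) ≤ Real.exp r := by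
            apply Real.exp_le_exp.2
            rw [div_le_iff₀ (by linarith)]
            simp; linarith
          rw [div_le_iff₀ (by positivity)]
          refine (h2.trans h3).trans ?_
          have h4 : Real.exp (5 * r) ≤ 2 ^ Δ := by
            rw [mul_comm, Real.exp_nat_mul, hΔ, pow_mul]
            gcongr
            rw [show (5:ℝ) = (5 : ℕ) * 1 by norm_num, Real.exp_nat_mul]
            calc Real.exp 1 ^ 5 ≤ 2.7182818286 ^ 5 := by gcongr; exact Real.exp_one_lt_d9.le
              _ ≤ 2 ^ 8 := by norm_num
          calc Real.exp r = Real.exp (-4 * r) * Real.exp (5 * r) := by rw [← Real.exp_add]; congr 1; ring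
            _ ≤ _ := by gcongr
      exact (pr_coord (fun x : Fin m → Fin q => Δ < (univ.filter (fun a => (x a : ℕ) = 0)).card) z).le.trans hpr
    refine (pr_exists_le _ _ h1).trans ?_
    rw [Fintype.card_fin]
    calc (m:ℝ) * Real.exp (-4 * r) ≤ Real.exp ℓ * Real.exp (-4 * r) := by gcongr
      _ = Real.exp (ℓ - 4 * r) := by rw [← Real.exp_add]; congr 1; ring
      _ ≤ Real.exp (-(6:ℕ) * 1) := Real.exp_le_exp.2 (by push_cast; linarith)
      _ ≤ 1 / 32 := by
        rw [neg_mul, Real.exp_neg, Real.exp_nat_mul, one_div]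
        apply inv_anti₀ (by norm_num)
        calc (32:ℝ) ≤ 2 ^ 6 := by norm_num
          _ ≤ _ := by gcongr; have := Real.add_one_le_exp (1:ℝ); linarith
  -- event B
  have hB : pr (fun M : Fin m → Fin m → Fin q => ∃ g : Fin q → Fin m,
      (q:ℝ) ^ 2 / 64 ≤ ∑ z, ((min ((univ.image g).filter (fun a => (M z a : ℕ) = 0)).card Δ : ℕ) : ℝ) ^ 2) ≤ 1 / 32 := by
    have h1 : ∀ g : Fin q → Fin m, pr (fun M : Fin m → Fin m → Fin q =>
        (q:ℝ) ^ 2 / 64 ≤ ∑ z, ((min ((univ.image g).filter (fun a => (M z a : ℕ) = 0)).card Δ : ℕ) : ℝ) ^ 2) ≤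
        Real.exp (- (2 * ℓ * q)) := by
      intro g
      have hcard : (univ.image g).card ≤ q := card_image_le.trans (by simp)
      obtain ⟨G, hG⟩ : ∃ G : (Fin m → Fin q) → ℝ, G = fun x => Real.exp ((min ((univ.image g).filter (fun a => (x a : ℕ) = 0)).card Δ : ℕ) ^ 2 / D) := ⟨_, rfl⟩
      have hG1 : av G ≤ Real.exp (60000 / D) := by
        rw [hG]; exact row_mgf m q hq _ hcard D Δ hD hY
      have hG0 : 0 ≤ av G := av_nonneg (fun x => by rw [hG]; positivity)
      refine (pr_markov (f := fun M : Fin m → Fin m → Fin q => ∏ z, G (M z))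
          (c := Real.exp (q ^ 2 / 64 / D)) (Real.exp_pos _) (fun M => ?_) (fun M hM => ?_)).trans ?_
      · apply prod_nonneg; intro z _; rw [hG]; positivity
      · rw [hG]
        simp only []
        rw [← Real.exp_sum, ← sum_div]
        apply Real.exp_le_exp.2
        gcongr
      · rw [av_pi (fun _ => G), prod_const, div_le_iff₀ (Real.exp_pos _), ← Real.exp_add]
        calc av G ^ (univ : Finset (Fin m)).card ≤ Real.exp (60000 / D) ^ (univ : Finset (Fin m)).card := by gcongr
          _ = Real.exp (m * (60000 / D)) := by rw [← Real.exp_nat_mul]; simp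
          _ ≤ _ := by
            apply Real.exp_le_exp.2
            have a1 : (m:ℝ) * (60000 / D) ≤ q ^ 2 / 128 / D := by
              rw [← mul_div_assoc]; gcongr; linarith
            have a2 : 2 * (ℓ:ℝ) * q ≤ q ^ 2 / 128 / D := by
              rw [le_div_iff₀ (by linarith), le_div_iff₀ (by norm_num)]
              nlinarith
            have a3 : (q:ℝ) ^ 2 / 64 / D = q ^ 2 / 128 / D + q ^ 2 / 128 / D := by ring
            linarith
    refine (pr_exists_le _ _ h1).trans ?_
    rw [Fintype.card_fun, Fintype.card_fin, Fintype.card_fin]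
    push_cast
    calc (m:ℝ) ^ q * Real.exp (- (2 * ℓ * q)) ≤ Real.exp ℓ ^ q * Real.exp (- (2 * ℓ * q)) := by gcongr
      _ = Real.exp (- (ℓ * q)) := by rw [← Real.exp_nat_mul, ← Real.exp_add]; congr 1; ring
      _ ≤ Real.exp (-(6:ℕ) * 1) := Real.exp_le_exp.2 (by push_cast; nlinarith)
      _ ≤ 1 / 32 := by
        rw [neg_mul, Real.exp_neg, Real.exp_nat_mul, one_div]
        apply inv_anti₀ (by norm_num)
        calc (32:ℝ) ≤ 2 ^ 6 := by norm_num
          _ ≤ _ := by gcongr; have := Real.add_one_le_exp (1:ℝ); linarith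
  refine (pr_mono ?_).trans (pr_or.trans ((add_le_add hA hB).trans (by norm_num)))
  intro M hM
  by_contra hcon
  push Not at hcon
  obtain ⟨hc1, hc2⟩ := hcon
  apply hM
  intro S hS
  let g : Fin q → Fin m := fun i => if h : (i : ℕ) < S.card then (S.equivFin.symm ⟨i, h⟩).1 else ⟨0, by omega⟩
  have hSg : S ⊆ univ.image g := by
    intro a ha
    rw [mem_image]
    have hlt := (S.equivFin ⟨a, ha⟩).2
    refine ⟨⟨(S.equivFin ⟨a, ha⟩ : ℕ), hlt.trans_le hS⟩, mem_univ _, ?_⟩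
    simp [g]
  have h2 := (hc2 g).le
  have h3 : ((∑ z, (S.filter (fun a => (M z a : ℕ) = 0)).card ^ 2 : ℕ) : ℝ) ≤ (q:ℝ) ^ 2 / 64 := by
    refine le_trans ?_ h2
    push_cast
    apply sum_le_sum
    intro z _
    have h4 : (S.filter (fun a => (M z a : ℕ) = 0)).card ≤ min ((univ.image g).filter (fun a => (M z a : ℕ) = 0)).card Δ := by
      apply le_min
      · exact card_le_card (filter_subset_filter _ hSg)
      · exact (card_le_card (filter_subset_filter _ (subset_univ _))).trans (hc1 z)
    gcongr
    exact_mod_cast h4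
  have h5 : ((64 * ∑ z, (S.filter (fun a => (M z a : ℕ) = 0)).card ^ 2 : ℕ) : ℝ) ≤ ((q ^ 2 : ℕ) : ℝ) := by
    push_cast at h3 ⊢; linarith
  exact_mod_cast h5

theorem pr_all_in {W : Type*} [Fintype W] [DecidableEq W] (m : ℕ) (hm : 1 ≤ m) (K : Finset W) (B : Finset (Fin m)) :
    pr (fun f : W → Fin m => ∀ x ∈ K, f x ∈ B) = ((B.card : ℝ) / m) ^ K.card := by
  classical
  have : Nonempty (Fin m) := ⟨⟨0, by omega⟩⟩
  unfold pr
  obtain ⟨g, hg⟩ : ∃ g : W → Fin m → ℝ, g = fun y x => if y ∈ K then (if x ∈ B then 1 else 0) else 1 := ⟨_, rfl⟩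
  have e1 : (fun f : W → Fin m => if (∀ x ∈ K, f x ∈ B) then (1:ℝ) else 0) = fun f => ∏ y, g y (f y) := by
    funext f
    rw [hg]
    simp only []
    rw [prod_ite_mem, univ_inter]
    by_cases h : ∀ x ∈ K, f x ∈ B
    · rw [if_pos h, prod_eq_one]; intro x hx; simp [h x hx]
    · rw [if_neg h]
      push Not at h
      obtain ⟨x, hx, hx'⟩ := h
      rw [prod_eq_zero hx]; simp [hx']
  have e2 := av_pi g
  rw [← e1] at e2
  refine Eq.trans ?_ (e2.trans ?_)
  · congr 1; funext f; congr
  have e3 : ∀ y, av (g y) = if y ∈ K then (B.card : ℝ) / m else 1 := by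
    intro y
    rw [hg]
    by_cases h : y ∈ K
    · simp [h, av]
    · simp only [h, if_false]; exact av_const 1
  simp only [e3]
  rw [prod_ite_mem, univ_inter, prod_const]

theorem choose_bound (ℓ h : ℕ) (hh : 1 ≤ h) : ((h * ℓ).choose (8 * h) : ℝ) ≤ (ℓ:ℝ) ^ (8 * h) := by
  have h1 : ((h * ℓ).choose (8 * h) : ℝ) ≤ ((h * ℓ : ℕ) : ℝ) ^ (8 * h) / (8 * h).factorial :=
    Nat.choose_le_pow_div (8 * h) (h * ℓ)
  have h2 := Real.pow_div_factorial_le_exp ((8 * h : ℕ) : ℝ) (by positivity) (8 * h)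
  have hf : (0:ℝ) < (8 * h).factorial := by exact_mod_cast Nat.factorial_pos _
  have hh' : (1:ℝ) ≤ h := by exact_mod_cast hh
  have h3 : Real.exp ((8 * h : ℕ) : ℝ) ≤ 8 ^ (8 * h) := by
    rw [show ((8 * h : ℕ) : ℝ) = ((8 * h : ℕ) : ℝ) * 1 by ring, Real.exp_nat_mul]
    gcongr; linarith [Real.exp_one_lt_d9]
  refine h1.trans ?_
  rw [div_le_iff₀ hf]
  rw [div_le_iff₀ hf] at h2
  have h4 : ((8 * h : ℕ) : ℝ) ^ (8 * h) ≤ 8 ^ (8 * h) * (8 * h).factorial := h2.trans (by gcongr)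
  have h5 : (h:ℝ) ^ (8 * h) ≤ (8 * h).factorial := by
    have : ((8 * h : ℕ) : ℝ) ^ (8 * h) = 8 ^ (8 * h) * (h:ℝ) ^ (8 * h) := by push_cast; rw [mul_pow]
    rw [this] at h4
    exact le_of_mul_le_mul_left h4 (by positivity)
  push_cast
  rw [mul_pow, mul_comm]
  gcongr

theorem cover_fn {α : Type*} [DecidableEq α] [Nonempty α] (h : ℕ) (S : Finset α) (hS : S.card ≤ h) :
    ∃ g : Fin h → α, S ⊆ univ.image g := by
  obtain ⟨a0⟩ := ‹Nonempty α›
  let g : Fin h → α := fun i => if h : (i : ℕ) < S.card then (S.equivFin.symm ⟨i, h⟩).1 else a0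
  refine ⟨g, ?_⟩
  intro a ha
  rw [mem_image]
  have hlt := (S.equivFin ⟨a, ha⟩).2
  refine ⟨⟨(S.equivFin ⟨a, ha⟩ : ℕ), hlt.trans_le hS⟩, mem_univ _, ?_⟩
  simp [g]

theorem labels (m ℓ h : ℕ) (hm : 1 ≤ m) (hl : 1 ≤ ℓ) (hh : 1 ≤ h)
    (hcond : 4 * m ^ 2 * (ℓ * h) ^ 8 ≤ m ^ 8) :
    ∃ f : Fin m × Fin ℓ → Fin m,
      m * ℓ ≤ 2 * (univ.filter (fun x => (univ.filter (fun y => f y = f x)).card ≤ 40 * ℓ)).card ∧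
      ∀ I : Finset (Fin m × Fin ℓ), I.card = 8 * h → h ≤ (I.image Prod.fst).card ∨ h ≤ (I.image f).card := by
  classical
  have hmne : Nonempty (Fin m) := ⟨⟨0, by omega⟩⟩
  have hm0 : (1:ℝ) ≤ m := by exact_mod_cast hm
  have hl0 : (1:ℝ) ≤ ℓ := by exact_mod_cast hl
  have hcond' : 4 * (m:ℝ) ^ 2 * (ℓ * h) ^ 8 ≤ m ^ 8 := by exact_mod_cast hcond
  have h1 : pr (fun f : Fin m × Fin ℓ → Fin m => ∃ AB : (Fin h → Fin m) × (Fin h → Fin m),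
      ∃ K : {K // K ∈ powersetCard (8 * h) ((univ.image AB.1) ×ˢ (univ : Finset (Fin ℓ)))},
        ∀ x ∈ K.1, f x ∈ univ.image AB.2) ≤ 1 / 4 := by
    have h2 : ∀ AB : (Fin h → Fin m) × (Fin h → Fin m), pr (fun f : Fin m × Fin ℓ → Fin m =>
      ∃ K : {K // K ∈ powersetCard (8 * h) ((univ.image AB.1) ×ˢ (univ : Finset (Fin ℓ)))},
        ∀ x ∈ K.1, f x ∈ univ.image AB.2) ≤ (ℓ:ℝ) ^ (8 * h) * ((h:ℝ) / m) ^ (8 * h) := by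
      intro AB
      have c1 : (univ.image AB.1).card ≤ h := card_image_le.trans (by simp)
      have c2 : (univ.image AB.2).card ≤ h := card_image_le.trans (by simp)
      refine (pr_exists_le _ (((h:ℝ) / m) ^ (8 * h)) ?_).trans ?_
      · rintro ⟨K, hK⟩
        rw [mem_powersetCard] at hK
        rw [pr_all_in m hm, hK.2]
        gcongr
      · gcongr
        rw [Fintype.card_coe, card_powersetCard, card_product, card_univ, Fintype.card_fin]
        refine le_trans ?_ (choose_bound ℓ h hh)
        exact_mod_cast Nat.choose_le_choose _ (Nat.mul_le_mul_right _ c1)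
    refine (pr_exists_le _ _ h2).trans ?_
    rw [Fintype.card_prod, Fintype.card_fun, Fintype.card_fin, Fintype.card_fin]
    push_cast
    have h3 : (m:ℝ) ^ h * m ^ h * (ℓ ^ (8 * h) * ((h:ℝ) / m) ^ (8 * h)) = (m ^ 2 * (ℓ * h) ^ 8 / m ^ 8) ^ h := by
      rw [← mul_pow, ← mul_pow, pow_mul, ← mul_pow]
      congr 1
      rw [← mul_div_assoc, div_pow]; ring
    rw [h3]
    have h4 : (m:ℝ) ^ 2 * (ℓ * h) ^ 8 / m ^ 8 ≤ 1 / 4 := by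
      rw [div_le_iff₀ (by positivity)]; linarith
    calc ((m:ℝ) ^ 2 * (ℓ * h) ^ 8 / m ^ 8) ^ h ≤ (1/4) ^ h := by gcongr
      _ ≤ (1/4) ^ 1 := pow_le_pow_of_le_one (by norm_num) (by norm_num) hh
      _ = 1/4 := by norm_num
  have hpair : ∀ x y : Fin m × Fin ℓ, x ≠ y → pr (fun f : Fin m × Fin ℓ → Fin m => f y = f x) ≤ 1 / m := by
    intro x y hxy
    refine (pr_mono (Q := fun f : Fin m × Fin ℓ → Fin m => ∃ a : Fin m, ∀ z ∈ ({x, y} : Finset _), f z ∈ ({a} : Finset (Fin m))) ?_).trans ?_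
    · intro f hf
      exact ⟨f x, by intro z hz; simp at hz; rcases hz with rfl | rfl <;> simp [hf]⟩
    · refine (pr_exists_le _ ((1 / (m:ℝ)) ^ 2) ?_).trans ?_
      · intro a
        rw [pr_all_in m hm, card_pair hxy]; simp
      · rw [Fintype.card_fin]
        apply le_of_eq; field_simp
  set cc : (Fin m × Fin ℓ → Fin m) → ℝ := fun f => ∑ x, ∑ y, if f y = f x then (1:ℝ) else 0 with hcc
  have hav : av cc ≤ (m * ℓ) * (1 + ℓ) := by
    rw [hcc, av_sum]
    have : ∀ x : Fin m × Fin ℓ, av (fun f : Fin m × Fin ℓ → Fin m => ∑ y, if f y = f x then (1:ℝ) else 0) ≤ 1 + ℓ := by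
      intro x
      rw [av_sum]
      have h5 : ∀ y ∈ univ, av (fun f : Fin m × Fin ℓ → Fin m => if f y = f x then (1:ℝ) else 0) ≤ (if y = x then 1 else 0) + 1 / m := by
        intro y _
        by_cases hxy : y = x
        · subst hxy; simp only [if_true]; rw [av_const]
          have : (0:ℝ) ≤ 1 / m := by positivity
          linarith
        · have := hpair x y (Ne.symm hxy)
          unfold pr at this
          simp only [hxy, if_false, zero_add]
          convert this using 2
          funext f; congr
      refine (sum_le_sum h5).trans ?_
      rw [sum_add_distrib]
      simp
      apply le_of_eq; field_simp
    refine (sum_le_sum fun x _ => this x).trans ?_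
    simp
    apply le_of_eq; ring
  have h6 : pr (fun f : Fin m × Fin ℓ → Fin m => (m:ℝ) * ℓ * (20 * ℓ) ≤ cc f) ≤ 1 / 10 := by
    refine (pr_markov (f := cc) (c := (m:ℝ) * ℓ * (20 * ℓ)) (by positivity) ?_ (fun f hf => hf)).trans ?_
    · intro f; rw [hcc]; positivity
    · rw [div_le_iff₀ (by positivity)]
      refine hav.trans ?_
      have : (m:ℝ) * ℓ * (1 + ℓ) ≤ m * ℓ * (2 * ℓ) := by gcongr; linarith
      linarith
  have h7 := exists_of_pr (lt_of_le_of_lt pr_or (lt_of_le_of_lt (add_le_add h1 h6) (by norm_num)))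
  obtain ⟨f, hf⟩ := h7
  push Not at hf
  obtain ⟨hf1, hf2⟩ := hf
  refine ⟨f, ?_, ?_⟩
  · by_contra hcon
    push Not at hcon
    set Vs := univ.filter (fun x => (univ.filter (fun y => f y = f x)).card ≤ 40 * ℓ) with hVs
    have e1 := card_filter_add_card_filter_not (s := (univ : Finset (Fin m × Fin ℓ))) (fun x => (univ.filter (fun y => f y = f x)).card ≤ 40 * ℓ)
    rw [← hVs, card_univ, Fintype.card_prod, Fintype.card_fin, Fintype.card_fin] at e1
    have e2 : (m:ℝ) * ℓ * (20 * ℓ) ≤ cc f := by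
      rw [hcc]
      have e3 : ∀ x ∈ univ.filter (fun x => ¬ (univ.filter (fun y => f y = f x)).card ≤ 40 * ℓ), (40 * ℓ : ℝ) ≤ ∑ y, if f y = f x then (1:ℝ) else 0 := by
        intro x hx
        simp only [mem_filter, mem_univ, true_and, not_le] at hx
        rw [sum_boole]
        exact_mod_cast hx.le
      have e4 : ∑ x ∈ univ.filter (fun x => ¬ (univ.filter (fun y => f y = f x)).card ≤ 40 * ℓ), (∑ y, if f y = f x then (1:ℝ) else 0) ≤
          ∑ x, ∑ y, if f y = f x then (1:ℝ) else 0 :=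
        sum_le_sum_of_subset_of_nonneg (subset_univ _) (fun x _ _ => by positivity)
      refine le_trans ?_ ((sum_le_sum e3).trans e4)
      rw [sum_const, nsmul_eq_mul]
      have e5 : (m:ℝ) * ℓ ≤ 2 * ((univ.filter (fun x => ¬ (univ.filter (fun y => f y = f x)).card ≤ 40 * ℓ)).card : ℝ) := by
        have : m * ℓ ≤ 2 * (univ.filter (fun x => ¬ (univ.filter (fun y => f y = f x)).card ≤ 40 * ℓ)).card := by omega
        exact_mod_cast this
      nlinarith
    linarith
  · intro I hI
    by_contra hcon
    push Not at hcon
    obtain ⟨A, hA⟩ := cover_fn h (I.image Prod.fst) hcon.1.le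
    obtain ⟨B, hB⟩ := cover_fn h (I.image f) hcon.2.le
    have hIm : I ∈ powersetCard (8 * h) ((univ.image A) ×ˢ (univ : Finset (Fin ℓ))) := by
      rw [mem_powersetCard]
      refine ⟨?_, hI⟩
      intro x hx
      rw [mem_product]
      exact ⟨hA (mem_image_of_mem _ hx), mem_univ _⟩
    obtain ⟨x, hx, hx'⟩ := hf1 (A, B) ⟨I, hIm⟩
    exact hx' (hB (mem_image_of_mem _ hx))

theorem core (E ℓ d : ℕ) (hE : E = 2 ^ 23) (hl : 2 ≤ ℓ) (h1 : 256 * ℓ ^ 3 ≤ d)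
    (h2 : Real.exp (ℓ / 4096) ≤ d)
    (h3 : ((E * (32768 * ℓ * d) ^ 2 * ℓ : ℕ) : ℝ) ≤ Real.exp ℓ) :
    ∃ (n r : ℕ) (G : SimpleGraph (Fin n)) (_ : DecidableRel G.Adj),
        (11 * 320 * 32768 * E) * (E * (32768 * ℓ * d) ^ 2 * ℓ) ≤ 2 * n ∧
        G.CliqueFree 3 ∧ G.IsRegularOfDegree r ∧
        ∀ s : Finset (Fin n), (∀ u ∈ s, ∀ v ∈ s, u ≠ v → ¬ G.Adj u v) →
          s.card < 2 * (11 * 320 * 32768 * E) * (8 * (E * (32768 * ℓ * d) * (40 * ℓ))) + 1 := by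
  classical
  have hE1 : 7680000 ≤ E := by rw [hE]; norm_num
  have hE0 : 1 ≤ E := by omega
  obtain ⟨r, hr⟩ : ∃ r, r = 32768 * ℓ * d := ⟨_, rfl⟩
  obtain ⟨q, hq⟩ : ∃ q, q = E * r := ⟨_, rfl⟩
  obtain ⟨m, hm⟩ : ∃ m, m = E * r ^ 2 := ⟨_, rfl⟩
  obtain ⟨h, hh⟩ : ∃ h, h = q * (40 * ℓ) := ⟨_, rfl⟩
  have hl3 : 1 ≤ ℓ ^ 3 := Nat.one_le_pow _ _ (by omega)
  have hd : 256 ≤ d := by omega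
  have hlr : 32768 * ℓ ≤ r := by rw [hr]; exact Nat.le_mul_of_pos_right _ (by omega)
  have hr1 : 65536 ≤ r := by omega
  have hqr : r ≤ q := by rw [hq]; exact Nat.le_mul_of_pos_left _ (by omega)
  have hq1 : 1 ≤ q := by omega
  have hmqr : m = q * r := by rw [hm, hq]; ring
  have hm1 : 1 ≤ m := by rw [hmqr]; exact Nat.mul_pos (by omega) (by omega)
  have hh1 : 80 ≤ h := by rw [hh]; nlinarith
  rw [← hr, ← hm] at h3
  rw [← hr, ← hm, ← hq, ← hh]
  -- nice
  have hl' : (2:ℝ) ≤ ℓ := by exact_mod_cast hl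
  have hd' : (256:ℝ) ≤ d := by exact_mod_cast hd
  have hE' : (1:ℝ) ≤ E := by exact_mod_cast hE0
  have hm' : (1:ℝ) ≤ m := by exact_mod_cast hm1
  have hq' : (1:ℝ) ≤ q := by exact_mod_cast hq1
  have hh' : (80:ℝ) ≤ h := by exact_mod_cast hh1
  push_cast at h3
  have hnice : pr (fun M => ¬ nice m q M) ≤ 1 / 16 := by
    apply nice_prob m q ℓ r (128 * E * d) hq1 (by nlinarith) hl (by omega) hm1
    · refine le_trans ?_ h3
      nlinarith
    · exact hmqr.le
    · rw [hm, hq]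
      calc 7680000 * (E * r ^ 2) ≤ E * (E * r ^ 2) := Nat.mul_le_mul_right _ hE1
        _ = _ := by ring
    · rw [hq, hr]; apply le_of_eq; ring
    · have e1 : ((8 * r : ℕ) : ℝ) / ((128 * E * d : ℕ) : ℝ) = ℓ / 4096 := by
        rw [hr, hE]; push_cast; field_simp; norm_num
      rw [e1]
      push_cast
      have he := Real.exp_one_lt_d9
      have : 2 * Real.exp 1 ≤ 128 * E := by linarith
      have hp := Real.exp_pos ((ℓ:ℝ) / 4096)
      exact mul_le_mul this h2 hp.le (by positivity)
  -- labels
  have hlab : 4 * m ^ 2 * (ℓ * h) ^ 8 ≤ m ^ 8 := by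
    have e1 : (ℓ * h) = 40 * ℓ ^ 2 * (E * r) := by rw [hh, hq]; ring
    have e2 : 4 * 40 ^ 8 * E ^ 2 * ℓ ^ 16 ≤ r ^ 4 := by
      have e3 : (32768 * ℓ * (256 * ℓ ^ 3)) ^ 4 ≤ r ^ 4 := by
        rw [hr]; gcongr
      refine le_trans ?_ e3
      have e4 : (32768 * ℓ * (256 * ℓ ^ 3)) ^ 4 = (32768 * 256) ^ 4 * ℓ ^ 16 := by ring
      rw [e4, hE]
      apply Nat.mul_le_mul_right
      norm_num
    rw [e1, hm]
    calc 4 * (E * r ^ 2) ^ 2 * (40 * ℓ ^ 2 * (E * r)) ^ 8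
        = (4 * 40 ^ 8 * E ^ 2 * ℓ ^ 16) * (E ^ 8 * r ^ 12) := by ring
      _ ≤ r ^ 4 * (E ^ 8 * r ^ 12) := Nat.mul_le_mul_right _ e2
      _ = _ := by ring
  obtain ⟨f, hf1, hf2⟩ := labels m ℓ h hm1 (by omega) (by omega) hlab
  obtain ⟨Vs, hVs⟩ : ∃ Vs : Finset (Fin m × Fin ℓ), Vs = univ.filter (fun x => (univ.filter (fun y => f y = f x)).card ≤ 40 * ℓ) := ⟨_, rfl⟩
  rw [← hVs] at hf1
  have hVcard : Fintype.card Vs = Vs.card := Fintype.card_coe Vs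
  have hVle : Vs.card ≤ m * ℓ := by
    refine (card_le_univ _).trans ?_
    simp
  have hfib1 : ∀ a, (univ.filter (fun x : Vs => x.1.1 = a)).card ≤ 40 * ℓ := by
    intro a
    have : (univ.filter (fun x : Vs => x.1.1 = a)).card ≤ (univ : Finset (Fin ℓ)).card := by
      apply card_le_card_of_injOn (fun x : Vs => x.1.2) (fun _ _ => by simp)
      intro x hx y hy hxy
      simp only [coe_filter, mem_univ, true_and, Set.mem_ofPred_eq] at hx hy
      exact Subtype.ext (Prod.ext (hx.trans hy.symm) hxy)
    rw [card_univ, Fintype.card_fin] at this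
    omega
  have hfib2 : ∀ a, (univ.filter (fun x : Vs => f x.1 = a)).card ≤ 40 * ℓ := by
    intro a
    rcases (univ.filter (fun x : Vs => f x.1 = a)).eq_empty_or_nonempty with h0 | ⟨x0, hx0⟩
    · rw [h0]; simp
    · simp only [mem_filter, mem_univ, true_and] at hx0
      have hx1 := (mem_filter.1 ((Finset.ext_iff.1 hVs x0.1).1 x0.2)).2
      refine le_trans ?_ hx1
      apply card_le_card_of_injOn (fun x : Vs => x.1)
      · intro x hx
        simp only [coe_filter, mem_univ, true_and, Set.mem_ofPred_eq] at hx ⊢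
        rw [hx, hx0]
      · exact Subtype.val_injective.injOn
  have hsmall : (Fintype.card Vs : ℝ) ^ (q * (40 * ℓ)) * (2 ^ (h * ℓ) * (1 - 1 / (2 * q : ℝ)) ^ (400 * ℓ ^ 2 * q ^ 2)) ≤ 1 / 4 := by
    rw [← hh]
    have a1 : (Fintype.card Vs : ℝ) ≤ Real.exp ℓ := by
      rw [hVcard]
      refine le_trans ?_ h3
      exact_mod_cast hVle
    have a2 : (2:ℝ) ≤ Real.exp 1 := by have := Real.add_one_le_exp (1:ℝ); linarith
    have a3 : (1 - 1 / (2 * q : ℝ)) ≤ Real.exp (- (1 / (2 * q))) := by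
      have := Real.add_one_le_exp (- (1 / (2 * q : ℝ))); linarith
    have a4 : 0 ≤ (1 - 1 / (2 * q : ℝ)) := by
      have : 1 / (2 * q : ℝ) ≤ 1 := by rw [div_le_one (by linarith)]; linarith
      linarith
    calc _ ≤ Real.exp ℓ ^ h * (Real.exp 1 ^ (h * ℓ) * Real.exp (- (1 / (2 * q))) ^ (400 * ℓ ^ 2 * q ^ 2)) := by gcongr
      _ = Real.exp (- (3 * h * ℓ)) := by
        rw [← Real.exp_nat_mul, ← Real.exp_nat_mul, ← Real.exp_nat_mul, ← Real.exp_add, ← Real.exp_add]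
        congr 1
        rw [hh]; push_cast; field_simp; ring
      _ ≤ Real.exp (-(2:ℕ) * 1) := Real.exp_le_exp.2 (by push_cast; nlinarith)
      _ ≤ 1 / 4 := by
        rw [neg_mul, Real.exp_neg, Real.exp_nat_mul, one_div]
        apply inv_anti₀ (by norm_num)
        calc (4:ℝ) = 2 ^ 2 := by norm_num
          _ ≤ _ := by gcongr
  obtain ⟨G, hG1, hG2⟩ := combine (V := Vs) m q (40 * ℓ) hq1 (by omega) (fun x => x.1.1) (fun x => f x.1)
    hfib1 hfib2 (400 * ℓ ^ 2 * q ^ 2) (h * ℓ) (by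
      have : 400 * ℓ ^ 2 * q ^ 2 * 4 = (q * (40 * ℓ)) ^ 2 := by ring
      rw [← hh] at this ⊢
      nlinarith) hnice hsmall
  rw [← hh] at hG2
  have hmE : m = E * r * r := by rw [hm]; ring
  obtain ⟨n, R, G', inst, hn, g1, g2, g3⟩ := from_dense G hG1 (8 * h) (h * ℓ) (ℓ * ℓ * d) (11 * 320 * 32768 * E) (by
      have : 1 ≤ ℓ * ℓ * d := Nat.mul_pos (Nat.mul_pos (by omega) (by omega)) (by omega)
      exact this) (by
      rw [hVcard]
      have : 2 * (4 * (8 * h)) ≤ m * ℓ := by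
        rw [hh, hmqr]
        have : 2560 ≤ r := by omega
        calc 2 * (4 * (8 * (q * (40 * ℓ)))) = q * ℓ * 2560 := by ring
          _ ≤ q * ℓ * r := Nat.mul_le_mul_left _ this
          _ = _ := by ring
      omega) (by
      rw [hVcard]
      have e1 : 2 * 32768 * (4 * (8 * h) ^ 2 * (ℓ * ℓ * d)) < 32768 * (h * ℓ * (m * ℓ)) := by
        have e2 : 32768 * (ℓ * ℓ * d) = ℓ * r := by rw [hr]; ring
        have e3 : 2 * 32768 * (4 * (8 * h) ^ 2 * (ℓ * ℓ * d)) = 20480 * (h * ℓ ^ 2 * q * r) := by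
          calc _ = 512 * h * h * (32768 * (ℓ * ℓ * d)) * 1 := by ring
            _ = _ * 1 := by rw [e2]
            _ = 512 * h * (q * (40 * ℓ)) * (ℓ * r) := by rw [← hh]; ring
            _ = _ := by ring
        have e4 : 32768 * (h * ℓ * (m * ℓ)) = 32768 * (h * ℓ ^ 2 * q * r) := by rw [hmqr]; ring
        rw [e3, e4]
        have : 0 < h * ℓ ^ 2 * q * r := by positivity
        omega
      have e5 : h * ℓ * (m * ℓ) ≤ h * ℓ * (2 * Vs.card) := Nat.mul_le_mul_left _ hf1
      have e6 : h * ℓ * (2 * Vs.card) = 2 * (h * ℓ * Vs.card) := by ring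
      omega) (by
      have e1 : 10 * (8 * h) = 10 * (320 * 32768 * E * (ℓ * ℓ * d)) := by rw [hh, hq, hr]; ring
      have e2 : (11 * 320 * 32768 * E) * (ℓ * ℓ * d) = 11 * (320 * 32768 * E * (ℓ * ℓ * d)) := by ring
      rw [e1, e2]
      have : 0 < 320 * 32768 * E * (ℓ * ℓ * d) := by positivity
      omega) (by
      intro I hI
      apply hG2
      have := hf2 (I.map ⟨Subtype.val, Subtype.val_injective⟩) (by rw [card_map, hI])
      rw [map_eq_image, image_image, image_image] at this
      exact this)
  refine ⟨n, R, G', inst, ?_, g1, g2, g3⟩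
  rw [hVcard] at hn
  calc (11 * 320 * 32768 * E) * (m * ℓ) ≤ (11 * 320 * 32768 * E) * (2 * Vs.card) := Nat.mul_le_mul_left _ hf1
    _ = 2 * ((11 * 320 * 32768 * E) * Vs.card) := by ring
    _ ≤ 2 * n := Nat.mul_le_mul_left _ hn

theorem big_exp (C : ℝ) : ∃ y0 : ℝ, ∀ y, y0 ≤ y → 1 ≤ y ∧ C * y ^ 5 ≤ Real.exp (y / 2) := by
  have h := (isLittleO_pow_exp_pos_mul_atTop (k := 5) (b := 1 / 2) (by norm_num)).def
    (c := 1 / (|C| + 1)) (by positivity)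
  have h2 := (h.and (Filter.eventually_ge_atTop (1:ℝ)))
  obtain ⟨y0, hy0⟩ := Filter.eventually_atTop.1 h2
  refine ⟨y0, fun y hy => ?_⟩
  obtain ⟨h3, h4⟩ := hy0 y hy
  refine ⟨h4, ?_⟩
  rw [Real.norm_of_nonneg (by positivity), Real.norm_of_nonneg (by positivity), one_div_mul_eq_div,
    le_div_iff₀ (by positivity)] at h3
  have h5 : C * y ^ 5 ≤ y ^ 5 * (|C| + 1) := by
    have : C ≤ |C| + 1 := by linarith [le_abs_self C]
    have hy5 : 0 ≤ y ^ 5 := by positivity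
    nlinarith
  refine h5.trans (h3.trans (le_of_eq ?_))
  congr 1; ring

theorem final_bound :
    ∃ c : ℝ, 0 < c ∧ ∀ t : ℕ, 3 ≤ t →
      ∃ (n r : ℕ) (G : SimpleGraph (Fin n)) (_ : DecidableRel G.Adj),
        c * (t : ℝ) ^ 2 / Real.log t ≤ (n : ℝ) ∧
        G.CliqueFree 3 ∧ G.IsRegularOfDegree r ∧
        ∀ s : Finset (Fin n), (∀ u ∈ s, ∀ v ∈ s, u ≠ v → ¬ G.Adj u v) → s.card < t := by
  obtain ⟨E, hE⟩ : ∃ E : ℕ, E = 2 ^ 23 := ⟨_, rfl⟩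
  have hE0 : 1 ≤ E := by rw [hE]; norm_num
  obtain ⟨Q, hQ⟩ : ∃ Q : ℕ, Q = 11 * 320 * 32768 * E := ⟨_, rfl⟩
  obtain ⟨A, hA⟩ : ∃ A : ℕ, A = 2 * Q * (8 * E * 32768 * 40) := ⟨_, rfl⟩
  obtain ⟨B, hB⟩ : ∃ B : ℕ, B = Q * E * 32768 ^ 2 := ⟨_, rfl⟩
  have hQ0 : 1 ≤ Q := by rw [hQ]; omega
  have hAE : E * 32768 ≤ A := by rw [hA]; nlinarith
  have hA0 : 1 ≤ A := by omega
  have hB0 : 1 ≤ B := by rw [hB]; have : 0 < Q * E * 32768 ^ 2 := by positivity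
                         exact this
  have hA' : (1:ℝ) ≤ A := by exact_mod_cast hA0
  have hB' : (1:ℝ) ≤ B := by exact_mod_cast hB0
  obtain ⟨y0, hy0⟩ := big_exp (512 * 3125 * A)
  refine ⟨min (Real.exp (-(2 * y0))) (B / (40 * A ^ 2)), by positivity, ?_⟩
  intro t ht
  have ht' : (3:ℝ) ≤ t := by exact_mod_cast ht
  have hlog1 : 1 ≤ Real.log t := by
    rw [Real.le_log_iff_exp_le (by linarith)]
    linarith [Real.exp_one_lt_d9]
  obtain ⟨y, hy⟩ : ∃ y, y = Real.log t := ⟨_, rfl⟩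
  have hty : Real.exp y = t := by rw [hy, Real.exp_log (by linarith)]
  rw [← hy] at hlog1 ⊢
  by_cases hcase : y0 ≤ y
  · obtain ⟨_, hbig⟩ := hy0 y hcase
    obtain ⟨ℓ, hℓ⟩ : ∃ ℓ : ℕ, ℓ = ⌈4 * y⌉₊ := ⟨_, rfl⟩
    have hl1 : 4 * y ≤ ℓ := by rw [hℓ]; exact Nat.le_ceil _
    have hl2 : (ℓ:ℝ) ≤ 5 * y := by
      have := Nat.ceil_lt_add_one (show 0 ≤ 4 * y by linarith)
      rw [← hℓ] at this; linarith
    have hl3 : 2 ≤ ℓ := by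
      have : (2:ℝ) ≤ ℓ := by linarith
      exact_mod_cast this
    have hl4 : (2:ℝ) ≤ ℓ := by exact_mod_cast hl3
    obtain ⟨X, hX⟩ : ∃ X : ℕ, X = A * ℓ ^ 2 := ⟨_, rfl⟩
    obtain ⟨d, hd⟩ : ∃ d : ℕ, d = (t - 1) / X := ⟨_, rfl⟩
    have hX0 : 0 < X := by rw [hX]; positivity
    have hXd : X * d + 1 ≤ t := by
      have := Nat.mul_div_le (t - 1) X
      rw [← hd] at this; omega
    have hXd2 : t ≤ X * (d + 1) := by
      have := Nat.lt_mul_div_succ (t - 1) hX0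
      rw [← hd] at this; omega
    have hXr : (X:ℝ) = A * ℓ ^ 2 := by rw [hX]; push_cast; ring
    have hexp1 : Real.exp (y / 2) ≤ t := by
      rw [← hty]; exact Real.exp_le_exp.2 (by linarith)
    have hl5 : 512 * A * (ℓ:ℝ) ^ 5 ≤ t := by
      have : (ℓ:ℝ) ^ 5 ≤ (5 * y) ^ 5 := by gcongr
      calc 512 * A * (ℓ:ℝ) ^ 5 ≤ 512 * A * (5 * y) ^ 5 := by gcongr
        _ = 512 * 3125 * A * y ^ 5 := by ring
        _ ≤ _ := hbig.trans hexp1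
    have hXpos : (0:ℝ) < X := by exact_mod_cast hX0
    have h2X : 2 * (X:ℝ) ≤ t := by
      refine le_trans ?_ hl5
      rw [hXr]
      have : (1:ℝ) ≤ ℓ ^ 3 := one_le_pow₀ (by linarith)
      have h7 : 0 ≤ (A:ℝ) * ℓ ^ 2 := by positivity
      calc 2 * ((A:ℝ) * ℓ ^ 2) ≤ 512 * ((A:ℝ) * (ℓ:ℝ) ^ 2) * 1 := by linarith
        _ ≤ 512 * ((A:ℝ) * (ℓ:ℝ) ^ 2) * (ℓ:ℝ) ^ 3 := by gcongr
        _ = _ := by ring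
    have hXd3 : (t:ℝ) ≤ X * (d + 1) := by exact_mod_cast hXd2
    have hdlow : (t:ℝ) ≤ 2 * X * d := by linarith
    have hc1 : 256 * ℓ ^ 3 ≤ d := by
      have : 2 * (X:ℝ) * (256 * ℓ ^ 3) ≤ 2 * X * d := by
        refine le_trans (le_of_eq ?_) (hl5.trans hdlow)
        rw [hXr]; ring
      have := le_of_mul_le_mul_left this (by positivity)
      exact_mod_cast this
    have hc2 : Real.exp (ℓ / 4096) ≤ d := by
      have e1 : Real.exp (ℓ / 4096) ≤ Real.exp (y / 2) := Real.exp_le_exp.2 (by linarith)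
      have e2 : 2 * (X:ℝ) ≤ Real.exp (y / 2) := by
        refine le_trans ?_ hbig
        rw [hXr]
        have e3 : (ℓ:ℝ) ^ 2 ≤ (5 * y) ^ 2 := by gcongr
        have e4 : y ^ 2 ≤ y ^ 5 := pow_le_pow_right₀ hlog1 (by norm_num)
        calc 2 * ((A:ℝ) * ℓ ^ 2) ≤ 2 * (A * (5 * y) ^ 2) := by gcongr
          _ = 50 * A * y ^ 2 := by ring
          _ ≤ 512 * 3125 * A * y ^ 5 := by gcongr; norm_num
      have e3 : 2 * (X:ℝ) * Real.exp (ℓ / 4096) ≤ 2 * X * d := by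
        refine le_trans ?_ hdlow
        calc 2 * (X:ℝ) * Real.exp (ℓ / 4096) ≤ Real.exp (y / 2) * Real.exp (y / 2) := by gcongr
          _ = t := by rw [← Real.exp_add, ← hty]; congr 1; ring
      exact le_of_mul_le_mul_left e3 (by positivity)
    have hc3 : ((E * (32768 * ℓ * d) ^ 2 * ℓ : ℕ) : ℝ) ≤ Real.exp ℓ := by
      have e1 : E * (32768 * ℓ * d) ^ 2 * ℓ ≤ (X * d) ^ 2 := by
        rw [hX]
        calc E * (32768 * ℓ * d) ^ 2 * ℓ = (E * 1) * 32768 ^ 2 * (ℓ ^ 3 * 1) * d ^ 2 := by ring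
          _ ≤ (E * E) * 32768 ^ 2 * (ℓ ^ 3 * ℓ) * d ^ 2 := by gcongr; omega
          _ = (E * 32768) ^ 2 * ℓ ^ 4 * d ^ 2 := by ring
          _ ≤ A ^ 2 * ℓ ^ 4 * d ^ 2 := by gcongr
          _ = _ := by ring
      have e2 : (X * d) ^ 2 ≤ t ^ 2 := Nat.pow_le_pow_left (by omega) 2
      calc ((E * (32768 * ℓ * d) ^ 2 * ℓ : ℕ) : ℝ) ≤ ((t ^ 2 : ℕ) : ℝ) := by exact_mod_cast e1.trans e2
        _ = Real.exp (2 * y) := by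
          push_cast; rw [← hty, ← Real.exp_nat_mul]; norm_num
        _ ≤ _ := Real.exp_le_exp.2 (by linarith)
    obtain ⟨n, r, G, inst, g0, g1, g2, g3⟩ := core E ℓ d hE hl3 hc1 hc2 hc3
    refine ⟨n, r, G, inst, ?_, g1, g2, ?_⟩
    · rw [← hQ] at g0
      have g0' : (B:ℝ) * ℓ ^ 3 * d ^ 2 ≤ 2 * n := by
        have : B * ℓ ^ 3 * d ^ 2 ≤ 2 * n := by
          refine le_trans (le_of_eq ?_) g0
          rw [hB]; ring
        exact_mod_cast this
      rw [div_le_iff₀ (by linarith)]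
      have hℓ0 : (0:ℝ) < ℓ := by linarith
      calc min (Real.exp (-(2 * y0))) ((B:ℝ) / (40 * (A:ℝ) ^ 2)) * (t:ℝ) ^ 2
          ≤ (B:ℝ) / (40 * (A:ℝ) ^ 2) * (2 * (X:ℝ) * (d:ℝ)) ^ 2 := by
            gcongr; exact min_le_right _ _
        _ = (B:ℝ) * (ℓ:ℝ) ^ 3 * (d:ℝ) ^ 2 * ℓ / 10 := by
            rw [hXr]
            have : (A:ℝ) ≠ 0 := by linarith
            field_simp; ring
        _ ≤ (2 * (n:ℝ)) * (5 * y) / 10 := by gcongr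
        _ = (n:ℝ) * y := by ring
    · intro s hs
      refine (g3 s hs).trans_le ?_
      rw [← hQ]
      refine le_trans (le_of_eq ?_) hXd
      rw [hX, hA]; ring
  · push Not at hcase
    refine ⟨1, 0, ⊥, inferInstance, ?_, ?_, ?_, ?_⟩
    · rw [div_le_iff₀ (by linarith)]
      calc min (Real.exp (-(2 * y0))) (B / (40 * A ^ 2)) * (t:ℝ) ^ 2 ≤ Real.exp (-(2 * y0)) * Real.exp y ^ 2 := by
            rw [hty]; gcongr; exact min_le_left _ _
        _ = Real.exp (2 * y - 2 * y0) := by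
            rw [← Real.exp_nat_mul, ← Real.exp_add]; congr 1; push_cast; ring
        _ ≤ 1 := by rw [Real.exp_le_one_iff]; linarith
        _ ≤ _ := by push_cast; linarith
    · exact SimpleGraph.cliqueFree_bot (by norm_num)
    · intro v; simp
    · intro s _
      have := card_le_univ s
      simp at this
      omega

end

/-- `R^reg(3,t) ≥ c · t² / log t`: there is a constant `c > 0` such that for every `t ≥ 3`
there exist `n ≥ c · t² / log t`, `r : ℕ`, and an `r`-regular triangle-free graph on `n`
vertices with no independent set of size `t`. -/
theorem regular_ramsey_lower_bound :
    ∃ c : ℝ, 0 < c ∧ ∀ t : ℕ, 3 ≤ t →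
      ∃ (n r : ℕ) (G : SimpleGraph (Fin n)) (_ : DecidableRel G.Adj),
        c * (t : ℝ) ^ 2 / Real.log t ≤ (n : ℝ) ∧
        G.CliqueFree 3 ∧ G.IsRegularOfDegree r ∧
        ∀ s : Finset (Fin n), (∀ u ∈ s, ∀ v ∈ s, u ≠ v → ¬ G.Adj u v) → s.card < t := by
  exact final_bound
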